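/- Let μ be a modulus of continuity satisfying the Osgood condition ∫₀¹ 1/μ(s) ds = +∞. Suppose that for all j,k = 1,…,n the coefficient a_{jk} belongs to C^μ([0,T], C²_b(ℝⁿ)), that a_{jk}(t,x) = a_{kj}(t,x) is real, and that there is λ₀ ∈ (0,1] with Σ_{j,k} a_{jk}(t,x) ξ_j ξ_k ≥ λ₀|ξ|² for all (t,x) ∈ [0,T]×ℝⁿ and ξ ∈ ℝⁿ. Let b_j, c : [0,T]×ℝⁿ → ℂ be measurable and bounded. Let u : [0,T]×ℝⁿ → ℂ be continuous, continuously differentiable in t, twice continuously differentiable in x, and suppose there exists C > 0 such that |u(t,x)|, |∂_t u(t,x)|, |∂_{x_j} u(t,x)|, |∂_{x_j}∂_{x_k} u(t,x)| ≤ C e^{C|x|} for all j,k and all (t,x) ∈ [0,T]×ℝⁿ. If ∂_t u + Σ_{j,k} ∂_{x_j}(a_{jk} ∂_{x_k} u) + Σ_j b_j ∂_{x_j} u + c u = 0 on [0,T]×ℝⁿ and u(0,x) = 0 for all x ∈ ℝⁿ, then u = 0 on all of [0,T]×ℝⁿ. -/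

import Mathlib

open MeasureTheory

namespace BU

set_option linter.unusedSectionVars false

/-- growth class -/
structure Gr {n : ℕ} {F : Type*} [NormedAddCommGroup F] (c : ℝ) (f : (Fin n → ℝ) → F) : Prop where
  cont : Continuous f
  bound : ∃ K, 0 ≤ K ∧ ∀ x, ‖f x‖ ≤ K * Real.exp (c * ‖x‖)

/-- partial derivative -/
noncomputable def pd {n : ℕ} {F : Type*} [NormedAddCommGroup F] [NormedSpace ℝ F] (j : Fin n)
    (f : (Fin n → ℝ) → F) (x : Fin n → ℝ) : F := fderiv ℝ f x (Pi.single j 1)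

/-- weight -/
noncomputable def wt {n : ℕ} (b : ℝ) (x : Fin n → ℝ) : ℝ :=
  Real.exp (-b * ∑ i, Real.sqrt (1 + x i ^ 2))

/-- log derivative of the weight -/
noncomputable def bt {n : ℕ} (b : ℝ) (j : Fin n) (x : Fin n → ℝ) : ℝ :=
  -b * (x j / Real.sqrt (1 + x j ^ 2))

section gr
variable {n : ℕ} {F : Type*} [NormedAddCommGroup F] [NormedSpace ℝ F] {c d : ℝ}
  {f g : (Fin n → ℝ) → F}

lemma Gr.add (hf : Gr c f) (hg : Gr c g) : Gr c (fun x => f x + g x) := by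
  obtain ⟨K, hK, h⟩ := hf.bound
  obtain ⟨L, hL, h'⟩ := hg.bound
  refine ⟨hf.cont.add hg.cont, K + L, by positivity, fun x => ?_⟩
  calc _ ≤ ‖f x‖ + ‖g x‖ := norm_add_le _ _
    _ ≤ _ := by rw [add_mul]; exact add_le_add (h x) (h' x)

lemma Gr.neg (hf : Gr c f) : Gr c (fun x => - f x) := by
  obtain ⟨K, hK, h⟩ := hf.bound
  exact ⟨hf.cont.neg, K, hK, fun x => by simpa using h x⟩

lemma Gr.sub (hf : Gr c f) (hg : Gr c g) : Gr c (fun x => f x - g x) := by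
  simpa [sub_eq_add_neg] using hf.add hg.neg

lemma Gr.zero : Gr c (fun _ : Fin n → ℝ => (0 : F)) :=
  ⟨continuous_const, 0, le_rfl, fun x => by simp⟩

lemma Gr.sum {ι : Type*} (s : Finset ι) {f : ι → (Fin n → ℝ) → F} (hf : ∀ i ∈ s, Gr c (f i)) :
    Gr c (fun x => ∑ i ∈ s, f i x) := by
  classical
  induction s using Finset.induction_on with
  | empty => simpa using Gr.zero
  | insert i s hi ih =>
    simp only [Finset.sum_insert hi]
    exact (hf i (by simp)).add (ih fun j hj => hf j (by simp [hj]))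

lemma Gr.smul {r : (Fin n → ℝ) → ℝ} (hr : Gr c r) (hf : Gr d f) :
    Gr (c + d) (fun x => r x • f x) := by
  obtain ⟨K, hK, h⟩ := hr.bound
  obtain ⟨L, hL, h'⟩ := hf.bound
  refine ⟨hr.cont.smul hf.cont, K * L, by positivity, fun x => ?_⟩
  rw [norm_smul]
  calc _ ≤ (K * Real.exp (c * ‖x‖)) * (L * Real.exp (d * ‖x‖)) := by
        gcongr
        · exact h x
        · exact h' x
    _ = _ := by rw [add_mul, Real.exp_add]; ring

lemma Gr.mul {r s : (Fin n → ℝ) → ℝ} (hr : Gr c r) (hf : Gr d s) :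
    Gr (c + d) (fun x => r x * s x) := hr.smul hf

lemma Gr.of_bdd (hf : Continuous f) (M : ℝ) (h : ∀ x, ‖f x‖ ≤ M) : Gr 0 f :=
  ⟨hf, M, (norm_nonneg _).trans (h 0), fun x => by simpa using h x⟩

lemma Gr.bsmul {r : (Fin n → ℝ) → ℝ} (hr : Gr 0 r) (hf : Gr d f) :
    Gr d (fun x => r x • f x) := by simpa using hr.smul hf

lemma Gr.csmul (r : ℝ) (hf : Gr d f) : Gr d (fun x => r • f x) :=
  (Gr.of_bdd (f := fun _ : Fin n → ℝ => r) continuous_const ‖r‖ (fun _ => le_rfl)).bsmul hf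

lemma Gr.cmul (r : ℝ) {f : (Fin n → ℝ) → ℝ} (hf : Gr d f) : Gr d (fun x => r * f x) :=
  hf.csmul r

lemma Gr.mono (hf : Gr c f) (h : c ≤ d) : Gr d f := by
  obtain ⟨K, hK, h'⟩ := hf.bound
  refine ⟨hf.cont, K, hK, fun x => (h' x).trans ?_⟩
  gcongr

lemma Gr.inner {F : Type*} [NormedAddCommGroup F] [InnerProductSpace ℝ F]
    {f g : (Fin n → ℝ) → F} (hf : Gr c f) (hg : Gr d g) :
    Gr (c + d) (fun x => inner ℝ (f x) (g x)) := by
  obtain ⟨K, hK, h⟩ := hf.bound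
  obtain ⟨L, hL, h'⟩ := hg.bound
  refine ⟨hf.cont.inner hg.cont, K * L, by positivity, fun x => ?_⟩
  calc _ ≤ ‖f x‖ * ‖g x‖ := norm_inner_le_norm _ _
    _ ≤ (K * Real.exp (c * ‖x‖)) * (L * Real.exp (d * ‖x‖)) := by
        gcongr
        · exact h x
        · exact h' x
    _ = _ := by rw [add_mul, Real.exp_add]; ring

lemma Gr.normsq (hf : Gr c f) : Gr (c + c) (fun x => ‖f x‖ ^ 2) := by
  obtain ⟨K, hK, h⟩ := hf.bound
  refine ⟨hf.cont.norm.pow 2, K * K, by positivity, fun x => ?_⟩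
  rw [Real.norm_of_nonneg (by positivity), sq]
  calc _ ≤ (K * Real.exp (c * ‖x‖)) * (K * Real.exp (c * ‖x‖)) := by
        gcongr
        · exact h x
        · exact h x
    _ = _ := by rw [add_mul, Real.exp_add]; ring

lemma integrable_exp_neg_abs {k : ℝ} (hk : 0 < k) : Integrable (fun x : ℝ => Real.exp (-k * |x|)) := by
  apply Integrable.of_integral_ne_zero
  rw [integral_comp_abs (f := fun x : ℝ => Real.exp (-k * x)),
    integral_exp_mul_Ioi (by linarith) 0]
  simp [hk.ne']

lemma sum_abs_le (x : Fin n → ℝ) : ∑ i, |x i| ≤ n * ‖x‖ := by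
  calc _ ≤ ∑ i : Fin n, ‖x‖ := Finset.sum_le_sum fun i _ => norm_le_pi_norm x i
    _ = _ := by simp

lemma norm_le_sum_abs (x : Fin n → ℝ) : ‖x‖ ≤ ∑ i, |x i| := by
  rw [pi_norm_le_iff_of_nonneg (Finset.sum_nonneg fun i _ => abs_nonneg _)]
  intro i
  exact Finset.single_le_sum (f := fun i => |x i|) (fun i _ => abs_nonneg _) (Finset.mem_univ i)

lemma integrable_exp_neg_norm {k : ℝ} (hk : k < 0) :
    Integrable (fun x : Fin n → ℝ => Real.exp (k * ‖x‖)) := by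
  have hk' : 0 < -k / (n + 1) := div_pos (by linarith) (by positivity)
  have h := Integrable.fintype_prod (ι := Fin n) (μ := fun _ => (volume : Measure ℝ))
    (f := fun _ x => Real.exp (-(-k / (n + 1)) * |x|)) (fun i => integrable_exp_neg_abs hk')
  refine h.mono' (by fun_prop) (Filter.Eventually.of_forall fun x => ?_)
  rw [Real.norm_of_nonneg (Real.exp_pos _).le, ← Real.exp_sum, ← Finset.mul_sum]
  apply Real.exp_le_exp.2
  have h1 := sum_abs_le x
  have : (-k / (n + 1)) * ∑ i, |x i| ≤ -k * ‖x‖ := by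
    rw [div_mul_eq_mul_div, div_le_iff₀ (by positivity)]
    nlinarith [norm_nonneg x]
  linarith

lemma Gr.integrable (hf : Gr c f) (hc : c < 0) : Integrable f := by
  obtain ⟨K, hK, h⟩ := hf.bound
  exact ((integrable_exp_neg_norm hc).const_mul K).mono' hf.cont.aestronglyMeasurable
    (Filter.Eventually.of_forall h)

lemma one_add_sq_pos (y : ℝ) : 0 < 1 + y ^ 2 := by positivity

lemma wt_pos (b : ℝ) (x : Fin n → ℝ) : 0 < wt b x := Real.exp_pos _

lemma wt_contDiff (b : ℝ) : ContDiff ℝ 1 (wt (n := n) b) := by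
  unfold wt
  refine Real.contDiff_exp.comp (contDiff_const.mul (ContDiff.sum fun i _ => ?_))
  exact ContDiff.sqrt (by fun_prop) fun x => (one_add_sq_pos _).ne'

lemma gr_wt {b : ℝ} (hb : 0 ≤ b) : Gr (-b) (wt (n := n) b) := by
  refine ⟨(wt_contDiff b).continuous, 1, zero_le_one, fun x => ?_⟩
  rw [Real.norm_of_nonneg (wt_pos b x).le, one_mul, wt]
  apply Real.exp_le_exp.2
  have : ‖x‖ ≤ ∑ i, Real.sqrt (1 + x i ^ 2) := (norm_le_sum_abs x).trans
    (Finset.sum_le_sum fun i _ => Real.abs_le_sqrt (by linarith))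
  nlinarith

lemma pd_wt (b : ℝ) (j : Fin n) (x : Fin n → ℝ) : pd j (wt b) x = bt b j x * wt b x := by
  have h1 : ∀ i, HasFDerivAt (fun x : Fin n → ℝ => Real.sqrt (1 + x i ^ 2))
      ((x i / Real.sqrt (1 + x i ^ 2)) • (ContinuousLinearMap.proj i : (Fin n → ℝ) →L[ℝ] ℝ)) x := by
    intro i
    have h2 : HasDerivAt (fun y : ℝ => Real.sqrt (1 + y ^ 2)) (x i / Real.sqrt (1 + x i ^ 2)) (x i) := by
      have := (((hasDerivAt_pow 2 (x i))).const_add 1).sqrt (one_add_sq_pos _).ne'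
      convert this using 1
      have := (Real.sqrt_pos.2 (one_add_sq_pos (x i))).ne'
      push_cast
      field_simp
    exact HasDerivAt.comp_hasFDerivAt (h₂ := fun y : ℝ => Real.sqrt (1 + y ^ 2))
      (f := fun x : Fin n → ℝ => x i) x h2
      ((ContinuousLinearMap.proj i : (Fin n → ℝ) →L[ℝ] ℝ).hasFDerivAt)
  have h3 := ((HasFDerivAt.fun_sum fun i (_ : i ∈ Finset.univ) => h1 i).const_mul (-b)).exp
  unfold pd
  have h4 : fderiv ℝ (wt b) x = _ := h3.fderiv
  rw [h4]
  simp [bt, wt, Pi.single_apply]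
  ring

lemma bt_cont (b : ℝ) (j : Fin n) : Continuous (bt b j) := by
  unfold bt
  refine continuous_const.mul (Continuous.div (by fun_prop) (by fun_prop) fun x => ?_)
  exact (Real.sqrt_pos.2 (one_add_sq_pos _)).ne'

lemma bt_abs {b : ℝ} (hb : 0 ≤ b) (j : Fin n) (x : Fin n → ℝ) : |bt b j x| ≤ b := by
  unfold bt
  rw [abs_mul, abs_neg, abs_of_nonneg hb, abs_div, abs_of_nonneg (Real.sqrt_nonneg _)]
  have : |x j| / Real.sqrt (1 + x j ^ 2) ≤ 1 := by
    rw [div_le_one (Real.sqrt_pos.2 (one_add_sq_pos _))]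
    exact Real.abs_le_sqrt (by linarith)
  nlinarith

lemma gr_bt {b : ℝ} (hb : 0 ≤ b) (j : Fin n) : Gr 0 (bt b j) :=
  Gr.of_bdd (bt_cont b j) b (bt_abs hb j)

/-- weighted integral -/
noncomputable def I (b : ℝ) (φ : (Fin n → ℝ) → ℝ) : ℝ := ∫ x, φ x * wt b x

lemma Gr.int {b : ℝ} {φ : (Fin n → ℝ) → ℝ} (h : Gr c φ) (hb : 0 ≤ b) (hc : c < b) :
    Integrable (fun x => φ x * wt b x) :=
  (h.mul (gr_wt hb)).integrable (by linarith)

lemma I_add {b : ℝ} {φ ψ : (Fin n → ℝ) → ℝ} (h : Gr c φ) (h' : Gr c ψ) (hb : 0 ≤ b) (hc : c < b) :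
    I b (fun x => φ x + ψ x) = I b φ + I b ψ := by
  unfold I
  rw [← integral_add (h.int hb hc) (h'.int hb hc)]
  simp only [add_mul]

lemma I_sub {b : ℝ} {φ ψ : (Fin n → ℝ) → ℝ} (h : Gr c φ) (h' : Gr c ψ) (hb : 0 ≤ b) (hc : c < b) :
    I b (fun x => φ x - ψ x) = I b φ - I b ψ := by
  unfold I
  rw [← integral_sub (h.int hb hc) (h'.int hb hc)]
  simp only [sub_mul]

lemma I_cmul {b : ℝ} (r : ℝ) (φ : (Fin n → ℝ) → ℝ) :
    I b (fun x => r * φ x) = r * I b φ := by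
  unfold I
  rw [← integral_const_mul]
  simp only [mul_assoc]

lemma I_neg {b : ℝ} (φ : (Fin n → ℝ) → ℝ) :
    I b (fun x => - φ x) = - I b φ := by
  simpa using I_cmul (-1) φ

lemma I_sum {ι : Type*} (s : Finset ι) {b : ℝ} {φ : ι → (Fin n → ℝ) → ℝ}
    (h : ∀ i ∈ s, Gr c (φ i)) (hb : 0 ≤ b) (hc : c < b) :
    I b (fun x => ∑ i ∈ s, φ i x) = ∑ i ∈ s, I b (φ i) := by
  unfold I
  rw [← integral_finsetSum s (fun i hi => (h i hi).int hb hc)]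
  simp only [Finset.sum_mul]

lemma I_mono {b : ℝ} {φ ψ : (Fin n → ℝ) → ℝ} (h : Gr c φ) (h' : Gr c ψ) (hb : 0 ≤ b) (hc : c < b)
    (hle : ∀ x, φ x ≤ ψ x) : I b φ ≤ I b ψ :=
  integral_mono (h.int hb hc) (h'.int hb hc)
    fun x => mul_le_mul_of_nonneg_right (hle x) (wt_pos b x).le

lemma I_nonneg {b : ℝ} {φ : (Fin n → ℝ) → ℝ} (hle : ∀ x, 0 ≤ φ x) : 0 ≤ I b φ :=
  integral_nonneg fun x => mul_nonneg (hle x) (wt_pos b x).le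

lemma pd_gr_cont {f : (Fin n → ℝ) → F} (hf : ContDiff ℝ 1 f) (j : Fin n) :
    Continuous (pd j f) :=
  (hf.continuous_fderiv one_ne_zero).clm_apply continuous_const

lemma hasDerivAt_line {f : (Fin n → ℝ) → F} (hf : ContDiff ℝ 1 f) (k : Fin n) (x : Fin n → ℝ)
    (h : ℝ) : HasDerivAt (fun h : ℝ => f (x + h • Pi.single k 1)) (pd k f (x + h • Pi.single k 1)) h := by
  have h1 : HasDerivAt (fun h : ℝ => x + h • (Pi.single k 1 : Fin n → ℝ)) (Pi.single k 1) h := by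
    simpa using ((hasDerivAt_id h).smul_const (Pi.single k 1 : Fin n → ℝ)).const_add x
  exact ((hf.differentiable one_ne_zero) _).hasFDerivAt.comp_hasDerivAt h h1

/-- integration by parts -/
lemma ibp {V : Type*} [NormedAddCommGroup V] [InnerProductSpace ℝ V]
    {P q : (Fin n → ℝ) → V} (hP : ContDiff ℝ 1 P) (hq : ContDiff ℝ 1 q) (j : Fin n)
    (gP : Gr c P) (gq : Gr d q) (gP' : Gr c (pd j P)) (gq' : Gr d (pd j q)) (hcd : c + d < 0) :
    ∫ x, inner ℝ (pd j P x) (q x) = - ∫ x, inner ℝ (P x) (pd j q x) := by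
  have := integral_bilinear_hasFDerivAt_right_eq_neg_left_of_integrable (μ := volume)
    (B := innerSL ℝ (E := V)) (f := P) (f' := fderiv ℝ P) (g := q) (g' := fderiv ℝ q)
    (v := Pi.single j 1) ((gP'.inner gq).integrable hcd) ((gP.inner gq').integrable hcd)
    ((gP.inner gq).integrable hcd) (fun x _ => ((hP.differentiable one_ne_zero) x).hasFDerivAt)
    (fun x _ => ((hq.differentiable one_ne_zero) x).hasFDerivAt)
  have h2 : ∫ x, inner ℝ (P x) (pd j q x) = - ∫ x, inner ℝ (pd j P x) (q x) := this
  rw [h2, neg_neg]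

lemma single_norm_le (k : Fin n) (h : ℝ) (hh : |h| ≤ 1) : ‖h • (Pi.single k 1 : Fin n → ℝ)‖ ≤ 1 := by
  rw [norm_smul, Real.norm_eq_abs]
  have : ‖(Pi.single k 1 : Fin n → ℝ)‖ ≤ 1 := by
    rw [Pi.norm_single]; simp
  nlinarith [norm_nonneg (Pi.single k 1 : Fin n → ℝ), abs_nonneg h]

lemma exp_shift (c K : ℝ) (hK : 0 ≤ K) (x y : Fin n → ℝ) (hy : ‖y‖ ≤ 1) :
    K * Real.exp (c * ‖x + y‖) ≤ (K * Real.exp |c|) * Real.exp (c * ‖x‖) := by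
  rw [mul_assoc, ← Real.exp_add]
  gcongr
  have h1 : |‖x + y‖ - ‖x‖| ≤ 1 := by
    refine (abs_norm_sub_norm_le _ _).trans (by simpa using hy)
  have : c * (‖x + y‖ - ‖x‖) ≤ |c| := by
    refine (le_abs_self _).trans ?_
    rw [abs_mul]; nlinarith [abs_nonneg c]
  linarith

lemma shift_deriv {V : Type*} [NormedAddCommGroup V] [InnerProductSpace ℝ V]
    {P q : (Fin n → ℝ) → V} (hq : ContDiff ℝ 1 q) (k : Fin n)
    (gP : Gr c P) (gq : Gr d q) (gq' : Gr d (pd k q)) (hcd : c + d < 0) :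
    HasDerivAt (fun h : ℝ => ∫ x, inner ℝ (P x) (q (x + h • Pi.single k 1)))
      (∫ x, inner ℝ (P x) (pd k q x)) 0 := by
  obtain ⟨K, hK, h⟩ := gP.bound
  obtain ⟨L, hL, h'⟩ := gq'.bound
  have := (hasDerivAt_integral_of_dominated_loc_of_deriv_le (μ := (volume : Measure (Fin n → ℝ)))
    (s := Metric.ball (0:ℝ) 1) (x₀ := (0:ℝ)) (F := fun h x => inner ℝ (P x) (q (x + h • Pi.single k 1)))
    (F' := fun h x => inner ℝ (P x) (pd k q (x + h • Pi.single k 1)))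
    (bound := fun x => (K * (L * Real.exp |d|)) * Real.exp ((c + d) * ‖x‖))
    (Metric.ball_mem_nhds _ one_pos) ?_ ?_ ?_ ?_ ?_ ?_).2
  · simpa using this
  · refine Filter.Eventually.of_forall fun h => Continuous.aestronglyMeasurable ?_
    exact gP.cont.inner (gq.cont.comp (by fun_prop))
  · simpa using (gP.inner gq).integrable hcd
  · refine Continuous.aestronglyMeasurable ?_
    exact gP.cont.inner (gq'.cont.comp (by fun_prop))
  · refine Filter.Eventually.of_forall fun x y hy => ?_
    have hy' : |y| ≤ 1 := by simpa using (Metric.mem_ball.1 hy).le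
    calc _ ≤ ‖P x‖ * ‖pd k q (x + y • Pi.single k 1)‖ := norm_inner_le_norm _ _
      _ ≤ (K * Real.exp (c * ‖x‖)) * ((L * Real.exp |d|) * Real.exp (d * ‖x‖)) := by
        gcongr
        · exact h x
        · exact (h' _).trans (exp_shift d L hL x _ (single_norm_le k y hy'))
      _ = _ := by rw [add_mul, Real.exp_add]; ring
  · exact (integrable_exp_neg_norm hcd).const_mul _
  · refine Filter.Eventually.of_forall fun x y hy => ?_
    exact (HasDerivAt.inner ℝ (hasDerivAt_const y (P x)) (hasDerivAt_line hq k x y)).congr_deriv (by simp)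

lemma Gr.shift {f : (Fin n → ℝ) → F} (hf : Gr c f) (y : Fin n → ℝ) (hy : ‖y‖ ≤ 1) :
    Gr c (fun x => f (x + y)) := by
  obtain ⟨K, hK, h⟩ := hf.bound
  exact ⟨hf.cont.comp (by fun_prop), K * Real.exp |c|, by positivity,
    fun x => (h _).trans (exp_shift c K hK x y hy)⟩

lemma pd_shift (f : (Fin n → ℝ) → F) (j : Fin n) (y : Fin n → ℝ) :
    pd j (fun x => f (x + y)) = fun x => pd j f (x + y) := by
  ext x
  unfold pd
  rw [fderiv_comp_add_right]

/-- null Lagrangian identity -/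
lemma null_lag {V : Type*} [NormedAddCommGroup V] [InnerProductSpace ℝ V]
    {P q : (Fin n → ℝ) → V} (hP : ContDiff ℝ 1 P) (hq : ContDiff ℝ 1 q) (j k : Fin n)
    (gP : Gr c P) (gq : Gr d q) (gP' : ∀ j, Gr c (pd j P)) (gq' : ∀ j, Gr d (pd j q))
    (hcd : c + d < 0) :
    ∫ x, inner ℝ (pd j P x) (pd k q x) = ∫ x, inner ℝ (pd k P x) (pd j q x) := by
  have h1 := shift_deriv hq k (gP' j) gq (gq' k) hcd
  have h2 := shift_deriv hP k (gq' j) gP (gP' k) (by linarith)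
  have h3 : HasDerivAt (fun h : ℝ => - ∫ x, inner ℝ (pd j q x) (P (x + (-h) • Pi.single k 1)))
      (∫ x, inner ℝ (pd j q x) (pd k P x)) 0 := by
    have h2' : HasDerivAt (fun h : ℝ => ∫ x, inner ℝ (pd j q x) (P (x + h • Pi.single k 1)))
      (∫ x, inner ℝ (pd j q x) (pd k P x)) (-0) := by simpa using h2
    have := (h2'.scomp (0:ℝ) (hasDerivAt_neg (0:ℝ))).neg
    refine (this.congr_deriv (by simp))
  have h4 : (fun h : ℝ => ∫ x, inner ℝ (pd j P x) (q (x + h • Pi.single k 1))) =ᶠ[nhds 0]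
      (fun h : ℝ => - ∫ x, inner ℝ (pd j q x) (P (x + (-h) • Pi.single k 1))) := by
    filter_upwards [Metric.ball_mem_nhds (0:ℝ) one_pos] with h hh
    have hy' : |h| ≤ 1 := by simpa using (Metric.mem_ball.1 hh).le
    have hn := single_norm_le k h hy'
    rw [ibp hP (q := fun x => q (x + h • Pi.single k 1)) (hq.comp (by fun_prop)) j gP
      (gq.shift _ hn) (gP' j) (by rw [pd_shift]; exact (gq' j).shift _ hn) hcd, pd_shift]
    have h5 := integral_add_right_eq_self (μ := (volume : Measure (Fin n → ℝ)))
      (fun x => inner ℝ (pd j q x) (P (x + (-h) • Pi.single k 1)) : (Fin n → ℝ) → ℝ)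
      (h • Pi.single k 1)
    rw [← h5]
    congr 2
    ext x
    rw [real_inner_comm]
    congr 2
    simp
  have := h1.unique (h3.congr_of_eventuallyEq h4)
  rw [this]
  congr 1; ext x; rw [real_inner_comm]

end gr
end BU
open MeasureTheory

namespace BU
set_option linter.unusedSectionVars false

/-- static coefficients -/
structure Co {n : ℕ} (M lam : ℝ) (a : Fin n → Fin n → (Fin n → ℝ) → ℝ) : Prop where
  cd : ∀ j k, ContDiff ℝ 1 (a j k)
  bd : ∀ j k x, |a j k x| ≤ M
  bd' : ∀ i j k x, |pd i (a j k) x| ≤ M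
  symm : ∀ j k x, a j k x = a k j x
  ell : ∀ x (ξ : Fin n → ℝ), lam * (∑ j, ξ j ^ 2) ≤ ∑ j, ∑ k, a j k x * ξ j * ξ k

/-- static functions -/
structure Fn {n : ℕ} (C : ℝ) (u : (Fin n → ℝ) → ℂ) : Prop where
  cd : ContDiff ℝ 2 u
  b0 : ∀ x, ‖u x‖ ≤ C * Real.exp (C * ‖x‖)
  b1 : ∀ j x, ‖pd j u x‖ ≤ C * Real.exp (C * ‖x‖)
  b2 : ∀ j k x, ‖pd j (pd k u) x‖ ≤ C * Real.exp (C * ‖x‖)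

/-- flux -/
noncomputable def flux {n : ℕ} (a : Fin n → Fin n → (Fin n → ℝ) → ℝ) (u : (Fin n → ℝ) → ℂ)
    (j : Fin n) (x : Fin n → ℝ) : ℂ := ∑ k, a j k x • pd k u x

/-- weighted elliptic operator -/
noncomputable def Op {n : ℕ} (b : ℝ) (a : Fin n → Fin n → (Fin n → ℝ) → ℝ) (u : (Fin n → ℝ) → ℂ)
    (x : Fin n → ℝ) : ℂ := - ∑ j, (pd j (flux a u j) x + bt b j x • flux a u j x)

/-- weighted form -/
noncomputable def Bf {n : ℕ} (b : ℝ) (a : Fin n → Fin n → (Fin n → ℝ) → ℝ)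
    (u g : (Fin n → ℝ) → ℂ) : ℝ :=
  I b (fun x => ∑ j, ∑ k, a j k x * inner ℝ (pd k u x) (pd j g x))

section
variable {n : ℕ} {M lam C b : ℝ} {a a' : Fin n → Fin n → (Fin n → ℝ) → ℝ}
  {u g w : (Fin n → ℝ) → ℂ}

lemma pd_cd (hu : ContDiff ℝ 2 u) (k : Fin n) : ContDiff ℝ 1 (pd k u) :=
  (hu.fderiv_right (m := 1) (by norm_num)).clm_apply contDiff_const

lemma Fn.cd1 (hu : Fn C u) : ContDiff ℝ 1 u := hu.cd.of_le (by norm_num)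

lemma Fn.g0 (hu : Fn C u) (hC : 0 ≤ C) : Gr C u := ⟨hu.cd.continuous, C, hC, hu.b0⟩
lemma Fn.g1 (hu : Fn C u) (hC : 0 ≤ C) (j : Fin n) : Gr C (pd j u) :=
  ⟨(pd_cd hu.cd j).continuous, C, hC, hu.b1 j⟩
lemma Fn.g2 (hu : Fn C u) (hC : 0 ≤ C) (j k : Fin n) : Gr C (pd j (pd k u)) :=
  ⟨pd_gr_cont (pd_cd hu.cd k) j, C, hC, hu.b2 j k⟩

lemma pd_comm (hu : ContDiff ℝ 2 u) (j k : Fin n) (x : Fin n → ℝ) :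
    pd j (pd k u) x = pd k (pd j u) x := by
  have hd : DifferentiableAt ℝ (fderiv ℝ u) x :=
    (hu.fderiv_right (m := 1) (by norm_num)).differentiable one_ne_zero x
  have key : ∀ j k : Fin n, pd j (pd k u) x = fderiv ℝ (fderiv ℝ u) x (Pi.single j 1) (Pi.single k 1) := by
    intro j k
    unfold pd
    rw [fderiv_clm_apply hd (differentiableAt_const _)]
    simp
  rw [key, key]
  have := (hu.contDiffAt (x := x)).isSymmSndFDerivAt (by simp)
  exact this _ _

lemma Co.g0 (ha : Co M lam a) (j k : Fin n) : Gr 0 (a j k) :=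
  Gr.of_bdd (ha.cd j k).continuous M (ha.bd j k)
lemma Co.g1 (ha : Co M lam a) (i j k : Fin n) : Gr 0 (pd i (a j k)) :=
  Gr.of_bdd (pd_gr_cont (ha.cd j k) i) M (ha.bd' i j k)

lemma flux_cd (ha : Co M lam a) (hu : ContDiff ℝ 2 u) (j : Fin n) : ContDiff ℝ 1 (flux a u j) :=
  ContDiff.sum fun k _ => (ha.cd j k).smul (pd_cd hu k)

lemma flux_gr (ha : Co M lam a) (hC : 0 ≤ C) (hu : Fn C u) (j : Fin n) : Gr C (flux a u j) :=
  Gr.sum _ fun k _ => (ha.g0 j k).bsmul (hu.g1 hC k)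

lemma pd_flux (ha : Co M lam a) (hu : ContDiff ℝ 2 u) (m j : Fin n) (x : Fin n → ℝ) :
    pd m (flux a u j) x = ∑ k, (pd m (a j k) x • pd k u x + a j k x • pd m (pd k u) x) := by
  have h : HasFDerivAt (flux a u j) _ x := HasFDerivAt.fun_sum fun k (_ : k ∈ Finset.univ) =>
    (((ha.cd j k).differentiable one_ne_zero x).hasFDerivAt.smul
      ((pd_cd hu k).differentiable one_ne_zero x).hasFDerivAt)
  unfold pd at h ⊢
  rw [h.fderiv]
  simp [add_comm]

lemma pd_flux_gr (ha : Co M lam a) (hC : 0 ≤ C) (hu : Fn C u) (m j : Fin n) :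
    Gr C (pd m (flux a u j)) := by
  have : pd m (flux a u j) = _ := funext fun x => pd_flux ha hu.cd m j x
  rw [this]
  exact Gr.sum _ fun k _ => ((ha.g1 m j k).bsmul (hu.g1 hC k)).add ((ha.g0 j k).bsmul (hu.g2 hC m k))

lemma Op_gr (ha : Co M lam a) (hC : 0 ≤ C) (hb : 0 ≤ b) (hu : Fn C u) : Gr C (Op b a u) :=
  (Gr.sum _ fun j _ => (pd_flux_gr ha hC hu j j).add ((gr_bt hb j).bsmul (flux_gr ha hC hu j))).neg

lemma pd_wsmul {f : (Fin n → ℝ) → ℂ} (hf : ContDiff ℝ 1 f) (m : Fin n) :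
    pd m (fun x => wt b x • f x) = fun x => wt b x • (pd m f x + bt b m x • f x) := by
  ext1 x
  have h := ((wt_contDiff b).differentiable one_ne_zero x).hasFDerivAt.smul
    ((hf).differentiable one_ne_zero x).hasFDerivAt
  have h' := pd_wt b m x
  have h2 : pd m (fun x => wt b x • f x) x = wt b x • pd m f x + pd m (wt b) x • f x := by
    unfold pd
    rw [show fderiv ℝ (fun x => wt b x • f x) x = _ from h.fderiv]
    simp
  rw [h2, h', smul_add, smul_smul, mul_comm]

lemma wsmul_cd {f : (Fin n → ℝ) → ℂ} (hf : ContDiff ℝ 1 f) : ContDiff ℝ 1 (fun x => wt b x • f x) :=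
  (wt_contDiff b).smul hf

/-- weighted ibp -/
lemma ibp_w {f g : (Fin n → ℝ) → ℂ} (hf : ContDiff ℝ 1 f) (hg : ContDiff ℝ 1 g) (j : Fin n)
    (hb : 0 ≤ b) (hCb : C + C < b) (gf : Gr C f) (gf' : Gr C (pd j f)) (gg : Gr C g)
    (gg' : Gr C (pd j g)) :
    I b (fun x => inner ℝ (- (pd j f x + bt b j x • f x)) (g x)) =
      I b (fun x => inner ℝ (f x) (pd j g x)) := by
  have h := ibp (c := -b + C) (d := C) (wsmul_cd (b := b) hf) hg j ((gr_wt hb).smul gf) gg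
    (by rw [pd_wsmul hf]; exact (gr_wt hb).smul (gf'.add ((gr_bt hb j).bsmul gf))) gg' (by linarith)
  rw [pd_wsmul hf] at h
  unfold I
  rw [← neg_inj, ← integral_neg]
  simp only [inner_neg_left, neg_mul, neg_neg]
  simp only [real_inner_smul_left] at h
  simpa only [mul_comm] using h

lemma null_lag_w {f g : (Fin n → ℝ) → ℂ} (hf : ContDiff ℝ 1 f) (hg : ContDiff ℝ 1 g) (j k : Fin n)
    (hb : 0 ≤ b) (hCb : C + C < b) (gf : Gr C f) (gf' : ∀ j, Gr C (pd j f)) (gg : Gr C g)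
    (gg' : ∀ j, Gr C (pd j g)) :
    I b (fun x => inner ℝ (pd j f x + bt b j x • f x) (pd k g x)) =
      I b (fun x => inner ℝ (pd k f x + bt b k x • f x) (pd j g x)) := by
  have h := null_lag (c := -b + C) (d := C) (wsmul_cd (b := b) hf) hg j k ((gr_wt hb).smul gf) gg
    (fun j => by rw [pd_wsmul hf]; exact (gr_wt hb).smul ((gf' j).add ((gr_bt hb j).bsmul gf))) gg'
    (by linarith)
  rw [pd_wsmul hf, pd_wsmul hf] at h
  simp only [real_inner_smul_left] at h
  unfold I
  simpa only [mul_comm] using h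

lemma Bf_eq (ha : Co M lam a) (hC : 0 ≤ C) (hb : 0 ≤ b) (hCb : C + C < b) (hu : Fn C u)
    (hg : Fn C g) : I b (fun x => inner ℝ (Op b a u x) (g x)) = Bf b a u g := by
  have h1 : (fun x => inner ℝ (Op b a u x) (g x)) = fun x => ∑ j,
      inner ℝ (- (pd j (flux a u j) x + bt b j x • flux a u j x)) (g x) := by
    ext x
    rw [Op, ← Finset.sum_neg_distrib, sum_inner]
  have h2 : (fun x => ∑ j, ∑ k, a j k x * inner ℝ (pd k u x) (pd j g x)) = fun x => ∑ j,
      inner ℝ (flux a u j x) (pd j g x) := by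
    ext x
    simp only [flux, sum_inner, real_inner_smul_left]
  rw [Bf, h1, h2, I_sum (c := C + C) _ _ hb hCb, I_sum (c := C + C) _ _ hb hCb]
  · refine Finset.sum_congr rfl fun j _ => ?_
    exact ibp_w (flux_cd ha hu.cd j) hg.cd1 j hb hCb (flux_gr ha hC hu j) (pd_flux_gr ha hC hu j j)
      (hg.g0 hC) (hg.g1 hC j)
  · intro j _
    exact (flux_gr ha hC hu j).inner (hg.g1 hC j)
  · intro j _
    exact ((pd_flux_gr ha hC hu j j).add ((gr_bt hb j).bsmul (flux_gr ha hC hu j))).neg.inner (hg.g0 hC)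

lemma Bf_symm (ha : Co M lam a) : Bf b a u g = Bf b a g u := by
  unfold Bf
  congr 1
  ext x
  rw [Finset.sum_comm]
  refine Finset.sum_congr rfl fun j _ => Finset.sum_congr rfl fun k _ => ?_
  rw [ha.symm, real_inner_comm]

lemma ell_c (ha : Co M lam a) (x : Fin n → ℝ) (ξ : Fin n → ℂ) :
    lam * ∑ j, ‖ξ j‖ ^ 2 ≤ ∑ j, ∑ k, a j k x * inner ℝ (ξ k) (ξ j) := by
  have h1 := ha.ell x (fun j => (ξ j).re)
  have h2 := ha.ell x (fun j => (ξ j).im)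
  calc _ = lam * (∑ j, (ξ j).re ^ 2) + lam * (∑ j, (ξ j).im ^ 2) := by
        rw [← mul_add, ← Finset.sum_add_distrib]
        congr 1
        refine Finset.sum_congr rfl fun j _ => ?_
        rw [← Complex.normSq_eq_norm_sq, Complex.normSq_apply]; ring
    _ ≤ _ := add_le_add h1 h2
    _ = _ := by
        rw [← Finset.sum_add_distrib]
        refine Finset.sum_congr rfl fun j _ => ?_
        rw [← Finset.sum_add_distrib]
        refine Finset.sum_congr rfl fun k _ => ?_
        rw [Complex.inner]
        simp
        ring

end
end BU
open MeasureTheory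

namespace BU
set_option linter.unusedSectionVars false
set_option linter.unusedVariables false

section
variable {n : ℕ} {M lam C b : ℝ} {a a' : Fin n → Fin n → (Fin n → ℝ) → ℝ}
  {u g w : (Fin n → ℝ) → ℂ}

/-- sum of squared gradients -/
noncomputable def Zf {n : ℕ} (u : (Fin n → ℝ) → ℂ) (x : Fin n → ℝ) : ℝ := ∑ k, ‖pd k u x‖ ^ 2
/-- sum of squared second derivatives -/
noncomputable def Sf {n : ℕ} (u : (Fin n → ℝ) → ℂ) (x : Fin n → ℝ) : ℝ :=
  ∑ j, ∑ m, ‖pd j (pd m u) x‖ ^ 2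

lemma Zf_gr (hC : 0 ≤ C) (hu : Fn C u) : Gr (C + C) (Zf u) :=
  Gr.sum _ fun k _ => (hu.g1 hC k).normsq
lemma Sf_gr (hC : 0 ≤ C) (hu : Fn C u) : Gr (C + C) (Sf u) :=
  Gr.sum _ fun j _ => Gr.sum _ fun k _ => (hu.g2 hC j k).normsq

lemma young_inner (al : ℝ) (hal : 0 < al) (z y : ℂ) :
    -(al / 4 * ‖y‖ ^ 2 + 1 / al * ‖z‖ ^ 2) ≤ inner ℝ z y := by
  have h1 := abs_le.1 (abs_real_inner_le_norm z y)
  have h2 : ‖z‖ * ‖y‖ ≤ al / 4 * ‖y‖ ^ 2 + 1 / al * ‖z‖ ^ 2 := by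
    have : al / 4 * ‖y‖ ^ 2 + 1 / al * ‖z‖ ^ 2 - ‖z‖ * ‖y‖ = 1 / al * (al / 2 * ‖y‖ - ‖z‖) ^ 2 := by
      field_simp; ring
    have h3 : 0 ≤ 1 / al * (al / 2 * ‖y‖ - ‖z‖) ^ 2 := by positivity
    linarith
  linarith [h1.1]

lemma sum_sq_le (f : Fin n → ℝ) : (∑ k, f k) ^ 2 ≤ n * ∑ k, f k ^ 2 := by
  simpa using sq_sum_le_card_mul_sum_sq (s := (Finset.univ : Finset (Fin n))) (f := f)

lemma flux_le (ha : Co M lam a) (u : (Fin n → ℝ) → ℂ) (j : Fin n) (x : Fin n → ℝ) :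
    ‖flux a u j x‖ ≤ M * ∑ k, ‖pd k u x‖ := by
  unfold flux
  refine (norm_sum_le _ _).trans ?_
  rw [Finset.mul_sum]
  refine Finset.sum_le_sum fun k _ => ?_
  rw [norm_smul]
  exact mul_le_mul_of_nonneg_right (ha.bd j k x) (norm_nonneg _)

lemma H2_pointwise (hlam : 0 < lam) (hM : 0 ≤ M) (hb : 0 ≤ b) (ha : Co M lam a)
    (hu : ContDiff ℝ 2 u) (x : Fin n → ℝ) :
    lam / 2 * Sf u x - (n / lam * ‖Op b a u x‖ ^ 2 + (n * n * ((M + b * M) ^ 2 * n) / lam) * Zf u x) ≤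
    ∑ j, ∑ m, inner ℝ (pd m (flux a u j) x + bt b m x • flux a u j x) (pd j (pd m u) x)
      + ∑ m, inner ℝ (Op b a u x) (pd m (pd m u) x) := by
  set O := Op b a u x
  set Bm : Fin n → Fin n → ℂ := fun j m =>
    ∑ k, pd m (a j k) x • pd k u x + bt b m x • flux a u j x with hBm
  have e1 : ∀ j m, inner ℝ (pd m (flux a u j) x + bt b m x • flux a u j x) (pd j (pd m u) x)
      = ∑ k, a j k x * inner ℝ (pd k (pd m u) x) (pd j (pd m u) x)
        + inner ℝ (Bm j m) (pd j (pd m u) x) := by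
    intro j m
    rw [pd_flux ha hu, Finset.sum_add_distrib, add_right_comm, inner_add_left, hBm, add_comm,
      sum_inner]
    congr 1
    refine Finset.sum_congr rfl fun k _ => ?_
    rw [real_inner_smul_left, pd_comm hu m k]
  have hB : ∀ j m, ‖Bm j m‖ ^ 2 ≤ (M + b * M) ^ 2 * n * Zf u x := by
    intro j m
    have h1 : ‖Bm j m‖ ≤ (M + b * M) * ∑ k, ‖pd k u x‖ := by
      rw [add_mul]
      refine (norm_add_le _ _).trans (add_le_add ?_ ?_)
      · refine (norm_sum_le _ _).trans ?_
        rw [Finset.mul_sum]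
        refine Finset.sum_le_sum fun k _ => ?_
        rw [norm_smul]
        exact mul_le_mul_of_nonneg_right (ha.bd' m j k x) (norm_nonneg _)
      · rw [norm_smul, mul_assoc]
        exact mul_le_mul (bt_abs hb m x) (flux_le ha u j x) (norm_nonneg _) hb
    calc _ ≤ ((M + b * M) * ∑ k, ‖pd k u x‖) ^ 2 := by gcongr
      _ = (M + b * M) ^ 2 * (∑ k, ‖pd k u x‖) ^ 2 := by ring
      _ ≤ (M + b * M) ^ 2 * (n * Zf u x) := by
          gcongr; exact sum_sq_le _
      _ = _ := by ring
  have t1 : lam * Sf u x ≤ ∑ j, ∑ m, ∑ k, a j k x * inner ℝ (pd k (pd m u) x) (pd j (pd m u) x) := by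
    rw [Sf, Finset.sum_comm, Finset.mul_sum]
    rw [Finset.sum_comm (f := fun j m => ∑ k, a j k x * inner ℝ (pd k (pd m u) x) (pd j (pd m u) x))]
    exact Finset.sum_le_sum fun m _ => ell_c ha x (fun j => pd j (pd m u) x)
  have t2 : -(lam / 4 * Sf u x + (n * n * ((M + b * M) ^ 2 * n) / lam) * Zf u x) ≤
      ∑ j, ∑ m, inner ℝ (Bm j m) (pd j (pd m u) x) := by
    calc _ = ∑ j : Fin n, ∑ m : Fin n, -(lam / 4 * ‖pd j (pd m u) x‖ ^ 2 +
            1 / lam * ((M + b * M) ^ 2 * n * Zf u x)) := by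
          simp only [Finset.sum_neg_distrib, Finset.sum_add_distrib, ← Finset.mul_sum, Sf]
          simp
          ring
      _ ≤ _ := by
          refine Finset.sum_le_sum fun j _ => Finset.sum_le_sum fun m _ => ?_
          refine le_trans ?_ (young_inner lam hlam _ _)
          have := hB j m
          gcongr
  have t3 : -(lam / 4 * Sf u x + n / lam * ‖O‖ ^ 2) ≤ ∑ m, inner ℝ O (pd m (pd m u) x) := by
    calc _ ≤ -(lam / 4 * ∑ m, ‖pd m (pd m u) x‖ ^ 2 + n / lam * ‖O‖ ^ 2) := by
          have : ∑ m, ‖pd m (pd m u) x‖ ^ 2 ≤ Sf u x :=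
            Finset.sum_le_sum fun m _ => Finset.single_le_sum
              (f := fun k => ‖pd m (pd k u) x‖ ^ 2) (fun k _ => by positivity) (Finset.mem_univ m)
          gcongr
      _ = ∑ m : Fin n, -(lam / 4 * ‖pd m (pd m u) x‖ ^ 2 + 1 / lam * ‖O‖ ^ 2) := by
          simp only [Finset.sum_neg_distrib, Finset.sum_add_distrib, ← Finset.mul_sum]
          simp
          ring
      _ ≤ _ := Finset.sum_le_sum fun m _ => young_inner lam hlam _ _
  simp only [e1, Finset.sum_add_distrib]
  linarith

lemma H2 (hlam : 0 < lam) (hM : 0 ≤ M) (hC : 0 ≤ C) (hb : 0 ≤ b) (hCb : C + C < b)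
    (ha : Co M lam a) (hu : Fn C u) :
    lam / 2 * I b (Sf u) ≤ n / lam * I b (fun x => ‖Op b a u x‖ ^ 2) +
      (n * n * ((M + b * M) ^ 2 * n) / lam) * I b (Zf u) := by
  have gF := fun j => flux_gr ha hC hu j
  have gF' := fun m j => pd_flux_gr ha hC hu m j
  have gO := Op_gr ha hC hb hu
  have gi : ∀ j m, Gr (C + C) (fun x => inner ℝ (pd m (flux a u j) x + bt b m x • flux a u j x)
      (pd j (pd m u) x)) := fun j m =>
    ((gF' m j).add ((gr_bt hb m).bsmul (gF j))).inner (hu.g2 hC j m)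
  have gi' : ∀ j m, Gr (C + C) (fun x => inner ℝ (pd j (flux a u j) x + bt b j x • flux a u j x)
      (pd m (pd m u) x)) := fun j m =>
    ((gF' j j).add ((gr_bt hb j).bsmul (gF j))).inner (hu.g2 hC m m)
  have gOi : ∀ m, Gr (C + C) (fun x => inner ℝ (Op b a u x) (pd m (pd m u) x)) := fun m =>
    gO.inner (hu.g2 hC m m)
  have hzero : I b (fun x => ∑ j, ∑ m, inner ℝ (pd m (flux a u j) x + bt b m x • flux a u j x)
      (pd j (pd m u) x) + ∑ m, inner ℝ (Op b a u x) (pd m (pd m u) x)) = 0 := by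
    rw [I_add (c := C + C) (Gr.sum _ fun j _ => Gr.sum _ fun m _ => gi j m)
      (Gr.sum _ fun m _ => gOi m) hb hCb,
      I_sum _ (fun j _ => Gr.sum _ fun m _ => gi j m) hb hCb]
    have : ∀ j, I b (fun x => ∑ m, inner ℝ (pd m (flux a u j) x + bt b m x • flux a u j x)
      (pd j (pd m u) x)) = I b (fun x => ∑ m, inner ℝ (pd j (flux a u j) x + bt b j x • flux a u j x)
      (pd m (pd m u) x)) := by
      intro j
      rw [I_sum _ (fun m _ => gi j m) hb hCb, I_sum _ (fun m _ => gi' j m) hb hCb]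
      refine Finset.sum_congr rfl fun m _ => ?_
      exact null_lag_w (flux_cd ha hu.cd j) (pd_cd hu.cd m) m j hb hCb (gF j) (fun i => gF' i j)
        (hu.g1 hC m) (fun i => hu.g2 hC i m)
    simp only [this]
    rw [← I_sum _ (fun j _ => Gr.sum _ fun m _ => gi' j m) hb hCb,
      ← I_add (c := C + C) (Gr.sum _ fun j _ => Gr.sum _ fun m _ => gi' j m)
      (Gr.sum _ fun m _ => gOi m) hb hCb]
    have : (fun x => ∑ j, ∑ m, inner ℝ (pd j (flux a u j) x + bt b j x • flux a u j x)
      (pd m (pd m u) x) + ∑ m, inner ℝ (Op b a u x) (pd m (pd m u) x)) = fun _ => 0 := by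
      ext x
      rw [Finset.sum_comm, ← Finset.sum_add_distrib]
      refine Finset.sum_eq_zero fun m _ => ?_
      rw [← sum_inner, ← inner_add_left, Op, add_neg_cancel, inner_zero_left]
    rw [this]
    simp [I]
  have hm := I_mono (c := C + C) (b := b)
    (((Sf_gr hC hu).cmul (lam / 2)).sub ((gO.normsq.cmul (n / lam)).add
      ((Zf_gr hC hu).cmul (n * n * ((M + b * M) ^ 2 * n) / lam))))
    ((Gr.sum _ fun j _ => Gr.sum _ fun m _ => gi j m).add (Gr.sum _ fun m _ => gOi m)) hb hCb
    (fun x => H2_pointwise hlam hM hb ha hu.cd x)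
  rw [hzero, I_sub ((Sf_gr hC hu).cmul (lam / 2)) ((gO.normsq.cmul (n / lam)).add
      ((Zf_gr hC hu).cmul (n * n * ((M + b * M) ^ 2 * n) / lam))) hb hCb,
    I_add (gO.normsq.cmul (n / lam))
      ((Zf_gr hC hu).cmul (n * n * ((M + b * M) ^ 2 * n) / lam)) hb hCb, I_cmul, I_cmul, I_cmul] at hm
  linarith

lemma Z_le (hlam : 0 < lam) (hC : 0 ≤ C) (hb : 0 ≤ b) (hCb : C + C < b)
    (ha : Co M lam a) (hu : Fn C u) : lam * I b (Zf u) ≤ Bf b a u u := by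
  rw [← I_cmul]
  refine I_mono (c := C + C) ((Zf_gr hC hu).cmul lam) ?_ hb hCb
    (fun x => ell_c ha x (fun j => pd j u x))
  exact Gr.sum _ fun j _ => Gr.sum _ fun k _ => by
    simpa using (ha.g0 j k).mul ((hu.g1 hC k).inner (hu.g1 hC j))

/-- squared L2 norm -/
noncomputable def hh {n : ℕ} (b : ℝ) (u : (Fin n → ℝ) → ℂ) : ℝ := I b (fun x => ‖u x‖ ^ 2)

lemma g_pointwise {η : ℝ} (hη : 0 ≤ η) (hM : 0 ≤ M) (hb : 0 ≤ b) (ha : Co M lam a)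
    (ha' : Co M lam a') (hu : ContDiff ℝ 2 u)
    (hd : ∀ j k x, |a j k x - a' j k x| ≤ M * η)
    (hd' : ∀ i j k x, |pd i (a j k) x - pd i (a' j k) x| ≤ M * η) (hη1 : η ≤ 1)
    (hw : ∀ x, ‖w x + ∑ j, pd j (flux a' u j) x‖ ≤ M * (∑ j, ‖pd j u x‖ + ‖u x‖)) (x : Fin n → ℝ) :
    ‖w x - Op b a u x‖ ≤ M * η * (∑ j, ∑ k, ‖pd j (pd k u) x‖) +
      (M + n * M + n * (b * M)) * (∑ j, ‖pd j u x‖ + ‖u x‖) := by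
  set s := ∑ j, ‖pd j u x‖ with hs
  have hs0 : 0 ≤ s := Finset.sum_nonneg fun _ _ => norm_nonneg _
  have e : w x - Op b a u x = (w x + ∑ j, pd j (flux a' u j) x) +
      ∑ j, ∑ k, ((pd j (a j k) x - pd j (a' j k) x) • pd k u x +
        (a j k x - a' j k x) • pd j (pd k u) x) + ∑ j, bt b j x • flux a u j x := by
    rw [Op, Finset.sum_add_distrib]
    have : ∀ j, ∑ k, ((pd j (a j k) x - pd j (a' j k) x) • pd k u x +
        (a j k x - a' j k x) • pd j (pd k u) x) = pd j (flux a u j) x - pd j (flux a' u j) x := by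
      intro j
      rw [pd_flux ha hu, pd_flux ha' hu, ← Finset.sum_sub_distrib]
      refine Finset.sum_congr rfl fun k _ => ?_
      rw [sub_smul, sub_smul]; abel
    simp only [this, Finset.sum_sub_distrib]
    abel
  have b3 : ‖∑ j, bt b j x • flux a u j x‖ ≤ n * (b * M) * s := by
    refine (norm_sum_le _ _).trans ?_
    calc _ ≤ ∑ j : Fin n, b * (M * s) := Finset.sum_le_sum fun j _ => by
            rw [norm_smul]
            exact mul_le_mul (bt_abs hb j x) (flux_le ha u j x) (norm_nonneg _) hb
      _ = _ := by simp; ring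
  have b2 : ‖∑ j, ∑ k, ((pd j (a j k) x - pd j (a' j k) x) • pd k u x +
        (a j k x - a' j k x) • pd j (pd k u) x)‖ ≤ n * M * s +
        M * η * (∑ j, ∑ k, ‖pd j (pd k u) x‖) := by
    calc _ ≤ ∑ j, ∑ k, (M * ‖pd k u x‖ + M * η * ‖pd j (pd k u) x‖) := by
          refine (norm_sum_le _ _).trans (Finset.sum_le_sum fun j _ => (norm_sum_le _ _).trans
            (Finset.sum_le_sum fun k _ => (norm_add_le _ _).trans (add_le_add ?_ ?_)))
          · rw [norm_smul]
            refine mul_le_mul_of_nonneg_right ((hd' j j k x).trans ?_) (norm_nonneg _)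
            nlinarith
          · rw [norm_smul]
            exact mul_le_mul_of_nonneg_right (hd j k x) (norm_nonneg _)
      _ = _ := by
          simp only [Finset.sum_add_distrib, ← Finset.mul_sum]
          simp [hs]
          ring
  rw [e]
  refine (norm_add_le _ _).trans ((add_le_add ((norm_add_le _ _).trans (add_le_add (hw x) b2)) b3).trans ?_)
  have : 0 ≤ (n * M + n * (b * M)) * ‖u x‖ := by positivity
  nlinarith

set_option maxHeartbeats 2000000 in
lemma g_L2 (n : ℕ) (M lam C b : ℝ) (hlam : 0 < lam) (hM : 0 ≤ M) (hC : 0 ≤ C) (hb : 0 ≤ b)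
    (hCb : C + C < b) : ∃ K, 1 ≤ K ∧ ∀ (a a' : Fin n → Fin n → (Fin n → ℝ) → ℝ)
    (u w : (Fin n → ℝ) → ℂ) (η : ℝ), 0 ≤ η → η ≤ 1 → Co M lam a → Co M lam a' → Fn C u → Gr C w →
    (∀ j k x, |a j k x - a' j k x| ≤ M * η) →
    (∀ i j k x, |pd i (a j k) x - pd i (a' j k) x| ≤ M * η) →
    (∀ x, ‖w x + ∑ j, pd j (flux a' u j) x‖ ≤ M * (∑ j, ‖pd j u x‖ + ‖u x‖)) →
    I b (fun x => ‖w x - Op b a u x‖ ^ 2) ≤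
      K * (η ^ 2 * I b (fun x => ‖Op b a u x‖ ^ 2) + Bf b a u u + hh b u) := by
  set c2 := M + n * M + n * (b * M) with hc2
  set k1 : ℝ := 2 * M ^ 2 * n * n with hk1
  set k2 : ℝ := 4 * c2 ^ 2 * n with hk2
  set k3 : ℝ := 4 * c2 ^ 2 with hk3
  set h1 : ℝ := (n / lam) * (2 / lam) with hh1
  set h2 : ℝ := (n * n * ((M + b * M) ^ 2 * n) / lam) * (2 / lam) with hh2
  have c20 : 0 ≤ c2 := by positivity
  have k10 : 0 ≤ k1 := by positivity
  have k20 : 0 ≤ k2 := by positivity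
  have k30 : 0 ≤ k3 := by positivity
  have h10 : 0 ≤ h1 := by positivity
  have h20 : 0 ≤ h2 := by positivity
  refine ⟨1 + k1 * h1 + (k1 * h2 + k2) / lam + k3, ?_, ?_⟩
  · have : 0 ≤ k1 * h1 + (k1 * h2 + k2) / lam + k3 := by positivity
    linarith
  intro a a' u w η hη hη1 ha ha' hu hw hd hd' hr
  have gO := Op_gr ha hC hb hu
  have step1 : I b (fun x => ‖w x - Op b a u x‖ ^ 2) ≤
      k1 * η ^ 2 * I b (Sf u) + k2 * I b (Zf u) + k3 * hh b u := by
    unfold hh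
    rw [← I_cmul, ← I_cmul, ← I_cmul,
      ← I_add ((Sf_gr hC hu).cmul _) ((Zf_gr hC hu).cmul _) hb hCb,
      ← I_add (((Sf_gr hC hu).cmul _).add ((Zf_gr hC hu).cmul _)) ((hu.g0 hC).normsq.cmul _) hb hCb]
    refine I_mono (hw.sub gO).normsq ((((Sf_gr hC hu).cmul _).add ((Zf_gr hC hu).cmul _)).add
      ((hu.g0 hC).normsq.cmul _)) hb hCb fun x => ?_
    have hp := g_pointwise hη hM hb ha ha' hu.cd hd hd' hη1 hr x
    set sD := ∑ j, ∑ k, ‖pd j (pd k u) x‖ with hsD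
    set s := ∑ j, ‖pd j u x‖ with hs
    have hsD2 : sD ^ 2 ≤ n * n * Sf u x := by
      calc _ ≤ n * ∑ j, (∑ k, ‖pd j (pd k u) x‖) ^ 2 := sum_sq_le _
        _ ≤ n * ∑ j, (n * ∑ k, ‖pd j (pd k u) x‖ ^ 2) := by
            gcongr; exact sum_sq_le _
        _ = _ := by rw [← Finset.mul_sum, Sf]; ring
    have hs2 : s ^ 2 ≤ n * Zf u x := sum_sq_le _
    calc _ ≤ (M * η * sD + c2 * (s + ‖u x‖)) ^ 2 := by gcongr
      _ ≤ 2 * M ^ 2 * η ^ 2 * sD ^ 2 + 4 * c2 ^ 2 * s ^ 2 + 4 * c2 ^ 2 * ‖u x‖ ^ 2 := by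
          nlinarith [sq_nonneg (M * η * sD - c2 * (s + ‖u x‖)), sq_nonneg (c2 * (s - ‖u x‖))]
      _ ≤ 2 * M ^ 2 * η ^ 2 * (n * n * Sf u x) + 4 * c2 ^ 2 * (n * Zf u x) + 4 * c2 ^ 2 * ‖u x‖ ^ 2 := by
          gcongr
      _ = _ := by rw [hk1, hk2, hk3]; ring
  have step2 : I b (Sf u) ≤ h1 * I b (fun x => ‖Op b a u x‖ ^ 2) + h2 * I b (Zf u) := by
    have := H2 hlam hM hC hb hCb ha hu
    have h' := mul_le_mul_of_nonneg_left this (show 0 ≤ 2 / lam by positivity)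
    calc _ = 2 / lam * (lam / 2 * I b (Sf u)) := by field_simp
      _ ≤ _ := h'
      _ = _ := by rw [hh1, hh2]; ring
  have step3 : I b (Zf u) ≤ Bf b a u u / lam := by
    rw [le_div_iff₀ hlam, mul_comm]; exact Z_le hlam hC hb hCb ha hu
  have Z0 : 0 ≤ I b (Zf u) := I_nonneg fun x => Finset.sum_nonneg fun _ _ => by positivity
  have hO0 : 0 ≤ I b (fun x => ‖Op b a u x‖ ^ 2) := I_nonneg fun x => by positivity
  have hh0 : 0 ≤ hh b u := I_nonneg fun x => by positivity
  have hB0 : 0 ≤ Bf b a u u := le_trans (by positivity) (Z_le hlam hC hb hCb ha hu)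
  have hη2 : η ^ 2 ≤ 1 := by nlinarith
  set OO := I b (fun x => ‖Op b a u x‖ ^ 2)
  set ZZ := I b (Zf u)
  calc _ ≤ k1 * η ^ 2 * I b (Sf u) + k2 * ZZ + k3 * hh b u := step1
    _ ≤ k1 * η ^ 2 * (h1 * OO + h2 * ZZ) + k2 * ZZ + k3 * hh b u := by gcongr
    _ = k1 * h1 * (η ^ 2 * OO) + (k1 * h2 * η ^ 2 + k2) * ZZ + k3 * hh b u := by ring
    _ ≤ k1 * h1 * (η ^ 2 * OO) + (k1 * h2 * 1 + k2) * (Bf b a u u / lam) + k3 * hh b u := by gcongr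
    _ = k1 * h1 * (η ^ 2 * OO) + ((k1 * h2 + k2) / lam) * Bf b a u u + k3 * hh b u := by ring
    _ ≤ _ := by
      have e1 : 0 ≤ (k1 * h2 + k2) / lam := by positivity
      have e2 : 0 ≤ k1 * h1 := by positivity
      have e3 : 0 ≤ η ^ 2 * OO := by positivity
      have p1 : 0 ≤ (1 + (k1 * h2 + k2) / lam + k3) * (η ^ 2 * OO) := by positivity
      have p2 : 0 ≤ (1 + k1 * h1 + k3) * Bf b a u u := by positivity
      have p3 : 0 ≤ (1 + k1 * h1 + (k1 * h2 + k2) / lam) * hh b u := by positivity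
      nlinarith

/-- key static inequality -/
lemma static_key {K η : ℝ} (hK : 1 ≤ K) (hη : 0 ≤ η) (hlam : 0 < lam) (hC : 0 ≤ C) (hb : 0 ≤ b)
    (hCb : C + C < b) (ha : Co M lam a) (hu : Fn C u) (hw : Gr C w)
    (hg : I b (fun x => ‖w x - Op b a u x‖ ^ 2) ≤
      K * (η ^ 2 * I b (fun x => ‖Op b a u x‖ ^ 2) + Bf b a u u + hh b u))
    (hKη : K * η ^ 2 ≤ 1) (hpos : 0 < hh b u) :
    -(K * (η ^ 2 * (Bf b a u u / hh b u + 1) ^ 2 + (Bf b a u u / hh b u + 1)) * hh b u) ≤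
      2 * I b (fun x => inner ℝ (w x) (Op b a u x)) -
      (Bf b a u u / hh b u) * (2 * I b (fun x => inner ℝ (w x) (u x))) := by
  set N := Bf b a u u / hh b u with hN
  have gO := Op_gr ha hC hb hu
  have gu := hu.g0 hC
  have hE : I b (fun x => inner ℝ (Op b a u x) (u x)) = Bf b a u u := Bf_eq ha hC hb hCb hu hu
  have hEN : Bf b a u u = N * hh b u := by rw [hN]; field_simp
  have hB0 : 0 ≤ Bf b a u u := le_trans (mul_nonneg hlam.le
    (I_nonneg fun x => Finset.sum_nonneg fun _ _ => by positivity)) (Z_le hlam hC hb hCb ha hu)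
  have hN0 : 0 ≤ N := by positivity
  set OO := I b (fun x => ‖Op b a u x‖ ^ 2) with hOO
  have hV : I b (fun x => ‖Op b a u x - N • u x‖ ^ 2) = OO - N ^ 2 * hh b u := by
    have e : (fun x => ‖Op b a u x - N • u x‖ ^ 2) = fun x => (‖Op b a u x‖ ^ 2
        - (2 * N) * inner ℝ (Op b a u x) (u x)) + N ^ 2 * ‖u x‖ ^ 2 := by
      ext x
      rw [norm_sub_sq_real, real_inner_smul_right, norm_smul, mul_pow, Real.norm_eq_abs, sq_abs]
      ring
    rw [e, I_add (gO.normsq.sub ((gO.inner gu).cmul _)) (gu.normsq.cmul _) hb hCb,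
      I_sub gO.normsq ((gO.inner gu).cmul _) hb hCb, I_cmul, I_cmul, hE, hEN]
    unfold hh
    ring
  set V := I b (fun x => ‖Op b a u x - N • u x‖ ^ 2) with hVdef
  have hV0 : 0 ≤ V := I_nonneg fun x => by positivity
  have hmain : V - I b (fun x => ‖w x - Op b a u x‖ ^ 2) ≤
      2 * I b (fun x => inner ℝ (w x) (Op b a u x)) - N * (2 * I b (fun x => inner ℝ (w x) (u x))) := by
    have e0 : 2 * I b (fun x => inner ℝ (w x) (Op b a u x)) -
        N * (2 * I b (fun x => inner ℝ (w x) (u x))) =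
        I b (fun x => ((2 * inner ℝ (w x) (Op b a u x) - (2 * N) * inner ℝ (w x) (u x))
          - (2 * N) * inner ℝ (Op b a u x) (u x)) + (2 * N ^ 2) * ‖u x‖ ^ 2) := by
      rw [I_add ((((hw.inner gO).cmul _).sub ((hw.inner gu).cmul _)).sub ((gO.inner gu).cmul _))
        (gu.normsq.cmul _) hb hCb, I_sub (((hw.inner gO).cmul _).sub ((hw.inner gu).cmul _))
        ((gO.inner gu).cmul _) hb hCb, I_sub ((hw.inner gO).cmul _) ((hw.inner gu).cmul _) hb hCb,
        I_cmul, I_cmul, I_cmul, I_cmul, hE, hEN]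
      unfold hh
      ring
    rw [e0, hVdef, ← I_sub (gO.sub (gu.csmul N)).normsq (hw.sub gO).normsq hb hCb]
    refine I_mono ((gO.sub (gu.csmul N)).normsq.sub (hw.sub gO).normsq)
      ((((((hw.inner gO).cmul _).sub ((hw.inner gu).cmul _)).sub ((gO.inner gu).cmul _))).add
        (gu.normsq.cmul _)) hb hCb fun x => ?_
    have h1 : 0 ≤ ‖(w x - Op b a u x) + (Op b a u x - N • u x)‖ ^ 2 := by positivity
    rw [norm_add_sq_real] at h1
    have h2 : inner ℝ (w x) (Op b a u x) - N * inner ℝ (w x) (u x) - N * inner ℝ (Op b a u x) (u x)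
        + N ^ 2 * ‖u x‖ ^ 2 = inner ℝ (w x - Op b a u x) (Op b a u x - N • u x)
          + ‖Op b a u x - N • u x‖ ^ 2 := by
      rw [← real_inner_self_eq_norm_sq (Op b a u x - N • u x), ← real_inner_self_eq_norm_sq (u x)]
      simp only [inner_sub_left, inner_sub_right, real_inner_smul_left, real_inner_smul_right]
      rw [real_inner_comm (Op b a u x) (u x)]
      ring
    nlinarith
  refine le_trans ?_ hmain
  have hOO' : OO = V + N ^ 2 * hh b u := by linarith
  rw [hOO', hEN] at hg
  have : K * η ^ 2 * V ≤ V := by nlinarith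
  have e1 : K * (η ^ 2 * N ^ 2) * hh b u ≤ K * (η ^ 2 * (N + 1) ^ 2) * hh b u := by
    gcongr; linarith
  nlinarith

lemma hderiv_le {K : ℝ} (hC : 0 ≤ C) (hb : 0 ≤ b)
    (hCb : C + C < b) (ha : Co M lam a) (hu : Fn C u) (hw : Gr C w)
    (hg : I b (fun x => ‖w x - Op b a u x‖ ^ 2) ≤ K * (Bf b a u u + hh b u)) :
    2 * I b (fun x => inner ℝ (w x) (u x)) ≤ (K + 2) * (Bf b a u u + hh b u) := by
  have gO := Op_gr ha hC hb hu
  have gu := hu.g0 hC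
  have hE : I b (fun x => inner ℝ (Op b a u x) (u x)) = Bf b a u u := Bf_eq ha hC hb hCb hu hu
  have hh0 : 0 ≤ hh b u := I_nonneg fun x => by positivity
  have : 2 * I b (fun x => inner ℝ (w x) (u x)) ≤
      2 * I b (fun x => inner ℝ (Op b a u x) (u x)) + I b (fun x => ‖w x - Op b a u x‖ ^ 2)
        + hh b u := by
    unfold hh
    rw [← I_cmul, ← I_cmul, ← I_add ((gO.inner gu).cmul _) (hw.sub gO).normsq hb hCb,
      ← I_add (((gO.inner gu).cmul _).add (hw.sub gO).normsq) gu.normsq hb hCb]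
    refine I_mono ((hw.inner gu).cmul _) ((((gO.inner gu).cmul _).add (hw.sub gO).normsq).add gu.normsq)
      hb hCb fun x => ?_
    have h1 : 0 ≤ ‖(w x - Op b a u x) - u x‖ ^ 2 := by positivity
    rw [norm_sub_sq_real, inner_sub_left] at h1
    linarith
  rw [hE] at this
  linarith

end
end BU
open MeasureTheory

namespace BU

section
variable {μ : ℝ → ℝ}

lemma mu_pos (hμ_mono : StrictMonoOn μ (Set.Icc 0 1)) (hμ_zero : μ 0 = 0) {s : ℝ} (h0 : 0 < s)
    (h1 : s ≤ 1) : 0 < μ s := by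
  rw [← hμ_zero]
  exact hμ_mono ⟨le_rfl, zero_le_one⟩ ⟨h0.le, h1⟩ h0

lemma mu_conc (hμ_conc : ConcaveOn ℝ (Set.Icc 0 1) μ) (hμ_zero : μ 0 = 0) {s r : ℝ} (h0 : 0 ≤ s)
    (h1 : s ≤ 1) (hr : 0 ≤ r) (hr1 : r ≤ 1) : r * μ s ≤ μ (r * s) := by
  have := hμ_conc.2 (x := s) ⟨h0, h1⟩ (y := 0) ⟨le_rfl, zero_le_one⟩ hr (sub_nonneg.2 hr1) (by ring)
  simpa [hμ_zero] using this

/-- tail Osgood integral -/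
noncomputable def Gl (μ : ℝ → ℝ) (r : ℝ) : ENNReal :=
  ∫⁻ s in Set.Ioo r 1, ENNReal.ofReal (1 / μ s)

lemma Gl_lt_top (hμ_mono : StrictMonoOn μ (Set.Icc 0 1)) (hμ_zero : μ 0 = 0) {r : ℝ} (h0 : 0 < r)
    (h1 : r ≤ 1) : Gl μ r < ⊤ := by
  have hp := mu_pos hμ_mono hμ_zero h0 h1
  calc Gl μ r ≤ ∫⁻ s in Set.Ioo r 1, ENNReal.ofReal (1 / μ r) := by
        refine setLIntegral_mono' measurableSet_Ioo fun s hs => ?_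
        apply ENNReal.ofReal_le_ofReal
        have := hμ_mono ⟨h0.le, h1⟩ ⟨h0.le.trans hs.1.le, hs.2.le⟩ hs.1
        exact one_div_le_one_div_of_le hp this.le
    _ < ⊤ := by
        rw [setLIntegral_const]
        exact ENNReal.mul_lt_top ENNReal.ofReal_lt_top (by simp)

lemma Gl_anti (r r' : ℝ) (h : r ≤ r') : Gl μ r' ≤ Gl μ r :=
  lintegral_mono_set (Set.Ioo_subset_Ioo_left h)

lemma Gl_lower (hOsgood : ∫⁻ s in Set.Ioo (0:ℝ) 1, ENNReal.ofReal (1 / μ s) = ⊤) (Γ : ENNReal)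
    (hΓ : Γ < ⊤) : ∃ e, 0 < e ∧ ∀ r, 0 < r → Gl μ r ≤ Γ → e ≤ r := by
  by_contra hcon
  push Not at hcon
  have hall : ∀ r, 0 < r → Gl μ r ≤ Γ := by
    intro r hr
    obtain ⟨r', h0, h1, h2⟩ := hcon r hr
    exact (Gl_anti _ _ h2.le).trans h1
  have hU : Set.Ioo (0:ℝ) 1 = ⋃ i : ℕ, Set.Ioo (1 / ((i:ℝ) + 1)) 1 := by
    ext x
    simp only [Set.mem_Ioo, Set.mem_iUnion]
    constructor
    · rintro ⟨h0, h1⟩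
      obtain ⟨i, hi⟩ := exists_nat_one_div_lt h0
      exact ⟨i, hi, h1⟩
    · rintro ⟨i, hi, h1⟩
      exact ⟨lt_trans (by positivity) hi, h1⟩
  have hmono : Monotone (fun i : ℕ => Set.Ioo (1 / ((i:ℝ) + 1)) 1) := by
    intro i j hij
    apply Set.Ioo_subset_Ioo_left
    apply one_div_le_one_div_of_le (by positivity)
    have : (i:ℝ) ≤ j := by exact_mod_cast hij
    linarith
  have hle : ∫⁻ s in Set.Ioo (0:ℝ) 1, ENNReal.ofReal (1 / μ s) ≤ Γ := by
    rw [hU, setLIntegral_iUnion_of_directed _ (hmono.directed_le)]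
    exact iSup_le fun i => hall _ (by positivity)
  rw [hOsgood] at hle
  exact absurd hΓ (not_lt.2 hle)

lemma Gl_step (hμ_mono : StrictMonoOn μ (Set.Icc 0 1)) (hμ_zero : μ 0 = 0)
    (hμ_conc : ConcaveOn ℝ (Set.Icc 0 1) μ) {c e : ℝ} (hc : 0 ≤ c) (he : 0 < e) (he1 : e ≤ 1) :
    Gl μ (e / (1 + c * μ e)) ≤ Gl μ e + ENNReal.ofReal (c * e) := by
  have hp := mu_pos hμ_mono hμ_zero he he1
  set d := 1 + c * μ e with hd
  have hd1 : 1 ≤ d := by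
    have : 0 ≤ c * μ e := by positivity
    linarith
  have hd0 : 0 < d := by linarith
  have he' : e / d ≤ e := div_le_self he.le hd1
  have he'0 : 0 < e / d := by positivity
  have hmu : μ e / d ≤ μ (e / d) := by
    have := mu_conc hμ_conc hμ_zero he.le he1 (r := 1 / d) (by positivity)
      ((div_le_one hd0).2 hd1)
    convert this using 1
    · ring
    · congr 1; ring
  have hp' : 0 < μ (e / d) := lt_of_lt_of_le (by positivity) hmu
  have hsub : Set.Ioo (e / d) 1 ⊆ Set.Ioo e 1 ∪ Set.Ioc (e / d) e := by
    intro x hx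
    rcases le_or_gt x e with h | h
    · exact Or.inr ⟨hx.1, h⟩
    · exact Or.inl ⟨h, hx.2⟩
  calc Gl μ (e / d) ≤ ∫⁻ s in Set.Ioo e 1 ∪ Set.Ioc (e / d) e, ENNReal.ofReal (1 / μ s) :=
        lintegral_mono_set hsub
    _ ≤ Gl μ e + ∫⁻ s in Set.Ioc (e / d) e, ENNReal.ofReal (1 / μ s) := lintegral_union_le _ _ _
    _ ≤ Gl μ e + ENNReal.ofReal (c * e) := by
        gcongr
        calc _ ≤ ∫⁻ s in Set.Ioc (e / d) e, ENNReal.ofReal (1 / μ (e / d)) := by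
              refine setLIntegral_mono' measurableSet_Ioc fun s hs => ?_
              apply ENNReal.ofReal_le_ofReal
              have := hμ_mono ⟨he'0.le, he'.trans he1⟩ ⟨he'0.le.trans hs.1.le, hs.2.trans he1⟩ hs.1
              exact one_div_le_one_div_of_le hp' this.le
          _ = ENNReal.ofReal (1 / μ (e / d) * (e - e / d)) := by
              rw [setLIntegral_const, Real.volume_Ioc, ← ENNReal.ofReal_mul (by positivity)]
          _ ≤ _ := by
              apply ENNReal.ofReal_le_ofReal
              rw [one_div, inv_mul_le_iff₀ hp']
              have h1 : e - e / d = (e / d) * (c * μ e) := by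
                field_simp; rw [hd]; ring
              rw [h1]
              calc e / d * (c * μ e) = (μ e / d) * (c * e) := by ring
                _ ≤ _ := by gcongr

lemma osgood_bound (hμ_mono : StrictMonoOn μ (Set.Icc 0 1)) (hμ_zero : μ 0 = 0)
    (hμ_conc : ConcaveOn ℝ (Set.Icc 0 1) μ) (hμ_mem : ∀ s ∈ Set.Icc (0:ℝ) 1, μ s ∈ Set.Icc (0:ℝ) 1)
    (hOsgood : ∫⁻ s in Set.Ioo (0:ℝ) 1, ENNReal.ofReal (1 / μ s) = ⊤)
    {t0 t1 κ c R0 : ℝ} (ht : t0 < t1) (hκ : 1 ≤ κ) (hc : 0 ≤ c) (hR0 : 1 ≤ R0) (Qd : ℝ → ℝ)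
    (step : ∀ s t R, t0 < t → t ≤ s → s ≤ t1 → R0 ≤ R → s - t ≤ 1 / (κ * R) → Qd s ≤ R →
      Qd t ≤ R * (1 + c * μ (1 / (κ * R)))) :
    ∃ B, ∀ t, t0 < t → t ≤ t1 → Qd t ≤ B := by
  set R1 := max R0 (Qd t1) with hR1
  have hR1' : 1 ≤ R1 := hR0.trans (le_max_left _ _)
  have eps1 : ∀ R, 1 ≤ R → 0 < 1 / (κ * R) ∧ 1 / (κ * R) ≤ 1 := by
    intro R hR
    have : 1 ≤ κ * R := by nlinarith
    exact ⟨by positivity, (div_le_one (by linarith)).2 this⟩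
  set Γ := Gl μ (1 / (κ * R1)) + ENNReal.ofReal (c * (t1 - t0)) with hΓ
  have hΓt : Γ < ⊤ := ENNReal.add_lt_top.2
    ⟨Gl_lt_top hμ_mono hμ_zero (eps1 _ hR1').1 (eps1 _ hR1').2, ENNReal.ofReal_lt_top⟩
  obtain ⟨e, he, hlow⟩ := Gl_lower hOsgood Γ hΓt
  have key : ∀ i : ℕ, ∀ s R, t0 < s → s ≤ t1 → R0 ≤ R → Qd s ≤ R →
      Gl μ (1 / (κ * R)) + ENNReal.ofReal (c * (s - t0)) ≤ Γ → s - t0 ≤ i * e →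
      ∀ t, t0 < t → t ≤ s → Qd t ≤ (1 / (κ * e)) * (1 + c) := by
    intro i
    induction i with
    | zero =>
      intro s R h0 _ _ _ _ h
      simp at h
      linarith
    | succ i ih =>
      intro s R hs0 hs1 hR hQ hG hsi t ht0 hts
      have hRp : 1 ≤ R := hR0.trans hR
      obtain ⟨hep, hep1⟩ := eps1 R hRp
      set ε := 1 / (κ * R) with hε
      have hee : e ≤ ε := hlow _ hep (le_trans le_self_add hG)
      have hmu := hμ_mem ε ⟨hep.le, hep1⟩
      rcases le_or_gt (s - t) ε with h | h
      · refine (step s t R ht0 hts hs1 hR h hQ).trans ?_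
        have hRe : R ≤ 1 / (κ * e) := by
          rw [le_div_iff₀ (by positivity)]
          rw [hε, le_div_iff₀ (by positivity)] at hee
          linarith
        have h1 := hmu.1
        have h2 : c * μ ε ≤ c := by nlinarith [hmu.2]
        gcongr
      · have hs' : t0 < s - ε := by linarith
        have hd1 : 1 ≤ 1 + c * μ ε := by
          have := mul_nonneg hc hmu.1
          linarith
        refine ih (s - ε) (R * (1 + c * μ ε)) hs' (by linarith) (by nlinarith)
          (step s (s - ε) R hs' (by linarith) hs1 hR (by linarith) hQ) ?_ ?_ t ht0 (by linarith)
        · have e1 : 1 / (κ * (R * (1 + c * μ ε))) = ε / (1 + c * μ ε) := by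
            rw [hε]; field_simp
          rw [e1]
          calc _ ≤ Gl μ ε + ENNReal.ofReal (c * ε) + ENNReal.ofReal (c * (s - ε - t0)) := by
                gcongr
                exact Gl_step hμ_mono hμ_zero hμ_conc hc hep hep1
            _ = Gl μ ε + ENNReal.ofReal (c * (s - t0)) := by
                rw [add_assoc, ← ENNReal.ofReal_add (by positivity)
                  (mul_nonneg hc (by linarith))]
                congr 2; ring
            _ ≤ Γ := hG
        · push_cast at hsi
          linarith
  obtain ⟨i, hi⟩ := exists_nat_ge ((t1 - t0) / e)
  refine ⟨_, fun t h0 h1 => key i t1 R1 ht le_rfl (le_max_left _ _) (le_max_right _ _) le_rfl ?_ t h0 h1⟩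
  rwa [div_le_iff₀ he] at hi

end
end BU
open MeasureTheory
set_option linter.unusedSectionVars false
set_option linter.unusedVariables false
namespace BU
open Filter Topology

lemma tend0 {n : ℕ} {ι : Type*} {l : Filter ι} [l.IsCountablyGenerated]
    {f g : ι → (Fin n → ℝ) → ℂ} {K L C b : ℝ} (hb : 0 ≤ b) (hCb : C + C < b) (hK : 0 ≤ K) (hL : 0 ≤ L)
    (hf : ∀ᶠ i in l, Continuous (f i) ∧ ∀ x, ‖f i x‖ ≤ K * Real.exp (C * ‖x‖))
    (hg : ∀ᶠ i in l, Continuous (g i) ∧ ∀ x, ‖g i x‖ ≤ L * Real.exp (C * ‖x‖))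
    (h0 : ∀ x, Tendsto (fun i => f i x) l (𝓝 0)) :
    Tendsto (fun i => I b (fun x => inner ℝ (f i x) (g i x))) l (𝓝 0) := by
  have hgr : Gr (n := n) (C + C) (fun x => K * L * Real.exp ((C + C) * ‖x‖)) :=
    ⟨by fun_prop, K * L, by positivity, fun x => by
      rw [Real.norm_of_nonneg (by positivity)]⟩
  have hitg := hgr.int hb hCb
  have key := tendsto_integral_filter_of_dominated_convergence (l := l)
    (F := fun i x => inner ℝ (f i x) (g i x) * wt b x) (f := fun _ : Fin n → ℝ => (0:ℝ))
    (μ := volume) _ ?_ ?_ hitg ?_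
  · simpa [I] using key
  · filter_upwards [hf, hg] with i hi hi'
    exact ((hi.1.inner hi'.1).mul (wt_contDiff b).continuous).aestronglyMeasurable
  · filter_upwards [hf, hg] with i hi hi'
    refine Eventually.of_forall fun x => ?_
    rw [norm_mul, Real.norm_of_nonneg (wt_pos b x).le]
    refine mul_le_mul_of_nonneg_right ?_ (wt_pos b x).le
    calc _ ≤ ‖f i x‖ * ‖g i x‖ := norm_inner_le_norm _ _
      _ ≤ (K * Real.exp (C * ‖x‖)) * (L * Real.exp (C * ‖x‖)) :=
        mul_le_mul (hi.2 x) (hi'.2 x) (norm_nonneg _) (by positivity)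
      _ = _ := by rw [add_mul, Real.exp_add]; ring
  · refine Eventually.of_forall fun x => ?_
    have h1 : Tendsto (fun i => ‖f i x‖ * (L * Real.exp (C * ‖x‖) * wt b x)) l (𝓝 0) := by
      simpa using ((h0 x).norm).mul_const (L * Real.exp (C * ‖x‖) * wt b x)
    refine squeeze_zero_norm' ?_ h1
    filter_upwards [hg] with i hi
    rw [norm_mul, Real.norm_of_nonneg (wt_pos b x).le, ← mul_assoc]
    refine mul_le_mul_of_nonneg_right ?_ (wt_pos b x).le
    exact (norm_inner_le_norm _ _).trans (mul_le_mul_of_nonneg_left (hi.2 x) (norm_nonneg _))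

lemma Op_bd {n : ℕ} {M lam C b : ℝ} {a : Fin n → Fin n → (Fin n → ℝ) → ℝ} {u : (Fin n → ℝ) → ℂ}
    (hM : 0 ≤ M) (hC : 0 ≤ C) (hb : 0 ≤ b) (ha : Co M lam a) (hu : Fn C u) (x : Fin n → ℝ) :
    ‖Op b a u x‖ ≤ (n * (n * (M * C + M * C) + b * (M * (n * C)))) * Real.exp (C * ‖x‖) := by
  unfold Op
  rw [norm_neg]
  set e := Real.exp (C * ‖x‖) with he
  have he0 : 0 < e := Real.exp_pos _
  have hj : ∀ j : Fin n, ‖pd j (flux a u j) x + bt b j x • flux a u j x‖ ≤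
      (n * (M * C + M * C) + b * (M * (n * C))) * e := by
    intro j
    have h1 : ‖pd j (flux a u j) x‖ ≤ (n * (M * C + M * C)) * e := by
      rw [pd_flux ha hu.cd]
      calc _ ≤ ∑ k : Fin n, (M * C + M * C) * e := by
            refine norm_sum_le_of_le _ fun k _ => (norm_add_le _ _).trans ?_
            rw [norm_smul, norm_smul, add_mul, mul_assoc, Real.norm_eq_abs, Real.norm_eq_abs]
            exact add_le_add (mul_le_mul (ha.bd' _ _ _ _) (hu.b1 _ _) (norm_nonneg _) hM)
              (mul_le_mul (ha.bd _ _ _) (hu.b2 _ _ _) (norm_nonneg _) hM)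
        _ = _ := by simp; ring
    have h2 : ‖flux a u j x‖ ≤ M * (n * C) * e := by
      refine (flux_le ha u j x).trans ?_
      rw [mul_assoc]
      refine mul_le_mul_of_nonneg_left ?_ hM
      calc _ ≤ ∑ k : Fin n, C * e := Finset.sum_le_sum fun k _ => hu.b1 _ _
        _ = _ := by simp; ring
    calc _ ≤ ‖pd j (flux a u j) x‖ + ‖bt b j x • flux a u j x‖ := norm_add_le _ _
      _ ≤ (n * (M * C + M * C)) * e + b * (M * (n * C) * e) := by
        rw [norm_smul, Real.norm_eq_abs]
        exact add_le_add h1 (mul_le_mul (bt_abs hb j x) h2 (norm_nonneg _) hb)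
      _ = _ := by ring
  calc _ ≤ ∑ j : Fin n, (n * (M * C + M * C) + b * (M * (n * C))) * e :=
        norm_sum_le_of_le _ fun j _ => hj j
    _ = _ := by simp; ring

/-- the dynamical hypotheses -/
structure Dy {n : ℕ} (T C M lam b : ℝ) (μ : ℝ → ℝ) (a : Fin n → Fin n → ℝ → (Fin n → ℝ) → ℝ)
    (u du : ℝ → (Fin n → ℝ) → ℂ) : Prop where
  hC : 0 ≤ C
  hCb : C + C < b
  hM : 0 ≤ M
  hlam : 0 < lam
  co : ∀ t ∈ Set.Icc 0 T, Co M lam (fun j k => a j k t)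
  md : ∀ t ∈ Set.Icc 0 T, ∀ s ∈ Set.Icc 0 T, |t - s| < 1 → ∀ j k x,
    |a j k t x - a j k s x| ≤ M * μ |t - s|
  md' : ∀ t ∈ Set.Icc 0 T, ∀ s ∈ Set.Icc 0 T, |t - s| < 1 → ∀ i j k x,
    |pd i (a j k t) x - pd i (a j k s) x| ≤ M * μ |t - s|
  fn : ∀ t ∈ Set.Icc 0 T, Fn C (u t)
  ut : ∀ t ∈ Set.Icc 0 T, ∀ x, HasDerivWithinAt (fun s => u s x) (du t x) (Set.Icc 0 T) t
  dux : ∀ t ∈ Set.Icc 0 T, Continuous (du t)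
  dut : ∀ x, ContinuousOn (fun t => du t x) (Set.Icc 0 T)
  dub : ∀ t ∈ Set.Icc 0 T, ∀ x, ‖du t x‖ ≤ C * Real.exp (C * ‖x‖)
  pde : ∀ t ∈ Set.Icc 0 T, ∀ x, ‖du t x + ∑ j, pd j (flux (fun j k => a j k t) (u t) j) x‖ ≤
    M * (∑ j, ‖pd j (u t) x‖ + ‖u t x‖)

section dy
variable {n : ℕ} {T C M lam b : ℝ} {μ : ℝ → ℝ} {a : Fin n → Fin n → ℝ → (Fin n → ℝ) → ℝ}
    {u du : ℝ → (Fin n → ℝ) → ℂ}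

lemma Dy.hb (D : Dy T C M lam b μ a u du) : 0 ≤ b := by linarith [D.hC, D.hCb]

lemma Dy.dug (D : Dy T C M lam b μ a u du) {t : ℝ} (ht : t ∈ Set.Icc 0 T) : Gr C (du t) :=
  ⟨D.dux t ht, C, D.hC, D.dub t ht⟩

/-- difference quotient -/
noncomputable def qq {n : ℕ} (u : ℝ → (Fin n → ℝ) → ℂ) (t t' : ℝ) (x : Fin n → ℝ) : ℂ :=
  (t' - t)⁻¹ • (u t' x - u t x)

lemma Dy.lip (D : Dy T C M lam b μ a u du) {t t' : ℝ} (ht : t ∈ Set.Icc 0 T) (ht' : t' ∈ Set.Icc 0 T)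
    (x : Fin n → ℝ) : ‖u t' x - u t x‖ ≤ C * Real.exp (C * ‖x‖) * ‖t' - t‖ :=
  Convex.norm_image_sub_le_of_norm_hasDerivWithin_le (f := fun s => u s x) (f' := fun s => du s x)
    (s := Set.Icc 0 T) (fun s hs => D.ut s hs x) (fun s hs => D.dub s hs x) (convex_Icc 0 T) ht ht'

lemma Dy.q_bd (D : Dy T C M lam b μ a u du) {t t' : ℝ} (ht : t ∈ Set.Icc 0 T) (ht' : t' ∈ Set.Icc 0 T)
    (x : Fin n → ℝ) : ‖qq u t t' x‖ ≤ C * Real.exp (C * ‖x‖) := by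
  unfold qq
  by_cases h : t' = t
  · simp [h]; have := D.hC; positivity
  have h0 : 0 < ‖t' - t‖ := norm_pos_iff.2 (sub_ne_zero.2 h)
  rw [norm_smul, norm_inv, inv_mul_le_iff₀ h0, mul_comm]
  exact D.lip ht ht' x

lemma Dy.q_gr (D : Dy T C M lam b μ a u du) {t t' : ℝ} (ht : t ∈ Set.Icc 0 T) (ht' : t' ∈ Set.Icc 0 T) :
    Gr C (qq u t t') :=
  ⟨by unfold qq; exact ((D.fn t' ht').cd.continuous.sub (D.fn t ht).cd.continuous).const_smul ((t' - t)⁻¹),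
    C, D.hC, D.q_bd ht ht'⟩

lemma Dy.q_tend (D : Dy T C M lam b μ a u du) {J : Set ℝ} (hJ : J ⊆ Set.Icc 0 T) {t : ℝ} (ht : t ∈ J)
    (x : Fin n → ℝ) : Tendsto (fun t' => qq u t t' x) (𝓝[J \ {t}] t) (𝓝 (du t x)) := by
  have := (hasDerivWithinAt_iff_tendsto_slope.1 ((D.ut t (hJ ht) x).mono hJ))
  refine this.congr fun t' => ?_
  simp [slope, qq]

lemma Dy.u_tend (D : Dy T C M lam b μ a u du) {J : Set ℝ} (hJ : J ⊆ Set.Icc 0 T) {t : ℝ} (ht : t ∈ J)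
    (x : Fin n → ℝ) : Tendsto (fun t' => u t' x) (𝓝[J] t) (𝓝 (u t x)) :=
  ((D.ut t (hJ ht) x).mono hJ).continuousWithinAt

lemma Dy.du_tend (D : Dy T C M lam b μ a u du) {J : Set ℝ} (hJ : J ⊆ Set.Icc 0 T) {t : ℝ} (ht : t ∈ J)
    (x : Fin n → ℝ) : Tendsto (fun t' => du t' x) (𝓝[J] t) (𝓝 (du t x)) :=
  ((D.dut x) t (hJ ht)).mono hJ

lemma two_bd {f g : (Fin n → ℝ) → ℂ} {K L C : ℝ} (hf : Continuous f ∧ ∀ x, ‖f x‖ ≤ K * Real.exp (C * ‖x‖))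
    (hg : Continuous g ∧ ∀ x, ‖g x‖ ≤ L * Real.exp (C * ‖x‖)) :
    (Continuous (fun x => f x + g x) ∧ ∀ x, ‖f x + g x‖ ≤ (K + L) * Real.exp (C * ‖x‖)) ∧
    (Continuous (fun x => f x - g x) ∧ ∀ x, ‖f x - g x‖ ≤ (K + L) * Real.exp (C * ‖x‖)) := by
  refine ⟨⟨hf.1.add hg.1, fun x => ?_⟩, ⟨hf.1.sub hg.1, fun x => ?_⟩⟩
  · rw [add_mul]; exact (norm_add_le _ _).trans (add_le_add (hf.2 x) (hg.2 x))
  · rw [add_mul]; exact (norm_sub_le _ _).trans (add_le_add (hf.2 x) (hg.2 x))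

lemma Dy.ubc (D : Dy T C M lam b μ a u du) {t : ℝ} (ht : t ∈ Set.Icc 0 T) :
    Continuous (u t) ∧ ∀ x, ‖u t x‖ ≤ C * Real.exp (C * ‖x‖) :=
  ⟨(D.fn t ht).cd.continuous, (D.fn t ht).b0⟩
lemma Dy.dubc (D : Dy T C M lam b μ a u du) {t : ℝ} (ht : t ∈ Set.Icc 0 T) :
    Continuous (du t) ∧ ∀ x, ‖du t x‖ ≤ C * Real.exp (C * ‖x‖) :=
  ⟨D.dux t ht, D.dub t ht⟩
lemma Dy.qbc (D : Dy T C M lam b μ a u du) {t t' : ℝ} (ht : t ∈ Set.Icc 0 T) (ht' : t' ∈ Set.Icc 0 T) :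
    Continuous (qq u t t') ∧ ∀ x, ‖qq u t t' x‖ ≤ C * Real.exp (C * ‖x‖) :=
  ⟨(D.q_gr ht ht').cont, D.q_bd ht ht'⟩

noncomputable def LO (n : ℕ) (M C b : ℝ) : ℝ := n * (n * (M * C + M * C) + b * (M * (n * C)))

lemma Dy.LO_nn (D : Dy T C M lam b μ a u du) : 0 ≤ LO n M C b := by
  have h1 := D.hC; have h2 := D.hM; have h3 := D.hb
  unfold LO; positivity

lemma Dy.Obc (D : Dy T C M lam b μ a u du) {s t : ℝ} (hs : s ∈ Set.Icc 0 T) (ht : t ∈ Set.Icc 0 T) :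
    Continuous (Op b (fun j k => a j k s) (u t)) ∧
      ∀ x, ‖Op b (fun j k => a j k s) (u t) x‖ ≤ LO n M C b * Real.exp (C * ‖x‖) :=
  ⟨(Op_gr (D.co s hs) D.hC D.hb (D.fn t ht)).cont, Op_bd D.hM D.hC D.hb (D.co s hs) (D.fn t ht)⟩

lemma gr_of_bc {f : (Fin n → ℝ) → ℂ} {K C : ℝ} (hK : 0 ≤ K)
    (hf : Continuous f ∧ ∀ x, ‖f x‖ ≤ K * Real.exp (C * ‖x‖)) : Gr C f := ⟨hf.1, K, hK, hf.2⟩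

/-- weighted pairing -/
noncomputable def ip (b : ℝ) (f g : (Fin n → ℝ) → ℂ) : ℝ := I b (fun x => inner ℝ (f x) (g x))

lemma ip_comm (f g : (Fin n → ℝ) → ℂ) : ip b f g = ip b g f := by
  unfold ip; congr 1; ext x; exact real_inner_comm _ _

lemma ip_add_left {f f' g : (Fin n → ℝ) → ℂ} (hb : 0 ≤ b) (hCb : C + C < b) (hf : Gr C f) (hf' : Gr C f')
    (hg : Gr C g) : ip b (fun x => f x + f' x) g = ip b f g + ip b f' g := by
  unfold ip
  rw [← I_add (hf.inner hg) (hf'.inner hg) hb hCb]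
  simp only [inner_add_left]

lemma ip_sub_left {f f' g : (Fin n → ℝ) → ℂ} (hb : 0 ≤ b) (hCb : C + C < b) (hf : Gr C f) (hf' : Gr C f')
    (hg : Gr C g) : ip b (fun x => f x - f' x) g = ip b f g - ip b f' g := by
  unfold ip
  rw [← I_sub (hf.inner hg) (hf'.inner hg) hb hCb]
  simp only [inner_sub_left]

lemma ip_add_right {f f' g : (Fin n → ℝ) → ℂ} (hb : 0 ≤ b) (hCb : C + C < b) (hf : Gr C f) (hf' : Gr C f')
    (hg : Gr C g) : ip b g (fun x => f x + f' x) = ip b g f + ip b g f' := by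
  rw [ip_comm, ip_add_left hb hCb hf hf' hg, ip_comm, ip_comm f']

lemma ip_sub_right {f f' g : (Fin n → ℝ) → ℂ} (hb : 0 ≤ b) (hCb : C + C < b) (hf : Gr C f) (hf' : Gr C f')
    (hg : Gr C g) : ip b g (fun x => f x - f' x) = ip b g f - ip b g f' := by
  rw [ip_comm, ip_sub_left hb hCb hf hf' hg, ip_comm, ip_comm f']

lemma ip_q (t t' : ℝ) (g : (Fin n → ℝ) → ℂ) :
    ip b (qq u t t') g = (t' - t)⁻¹ * ip b (fun x => u t' x - u t x) g := by
  unfold ip qq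
  rw [← I_cmul]
  simp only [inner_smul_left]; rfl

lemma ip_self (f : (Fin n → ℝ) → ℂ) : ip b f f = hh b f := by
  unfold ip hh; simp only [real_inner_self_eq_norm_sq]

end dy
end BU
open MeasureTheory
set_option linter.unusedSectionVars false
set_option linter.unusedVariables false
namespace BU
open Filter Topology

section dy
variable {n : ℕ} {T C M lam b : ℝ} {μ : ℝ → ℝ} {a : Fin n → Fin n → ℝ → (Fin n → ℝ) → ℝ}
    {u du : ℝ → (Fin n → ℝ) → ℂ}

lemma mem_diff_ev {J : Set ℝ} {t : ℝ} : ∀ᶠ t' in 𝓝[J \ {t}] t, t' ∈ J ∧ t' ≠ t := by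
  filter_upwards [self_mem_nhdsWithin] with t' h
  exact ⟨h.1, h.2⟩

lemma mem_ev {J : Set ℝ} {t : ℝ} : ∀ᶠ t' in 𝓝[J] t, t' ∈ J := self_mem_nhdsWithin

/-- slope of a quadratic form of a symmetric kind -/
lemma Dy.h_slope (D : Dy T C M lam b μ a u du) {t t' : ℝ} (ht : t ∈ Set.Icc 0 T) (ht' : t' ∈ Set.Icc 0 T) :
    slope (fun t => hh b (u t)) t t' = ip b (qq u t t') (fun x => u t' x + u t x) := by
  have g := (D.fn t ht).g0 D.hC
  have g' := (D.fn t' ht').g0 D.hC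
  rw [ip_q, ip_add_right D.hb D.hCb g' g (g'.sub g), ip_sub_left D.hb D.hCb g' g g',
    ip_sub_left D.hb D.hCb g' g g, ip_comm (u t) (u t'), ip_self, ip_self, slope_def_field]
  ring

lemma Dy.E_slope (D : Dy T C M lam b μ a u du) {s t t' : ℝ} (hs : s ∈ Set.Icc 0 T)
    (ht : t ∈ Set.Icc 0 T) (ht' : t' ∈ Set.Icc 0 T) :
    slope (fun t => Bf b (fun j k => a j k s) (u t) (u t)) t t' =
      ip b (qq u t t') (Op b (fun j k => a j k s) (u t')) +
      ip b (qq u t t') (Op b (fun j k => a j k s) (u t)) := by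
  have g := (D.fn t ht).g0 D.hC
  have g' := (D.fn t' ht').g0 D.hC
  have o := gr_of_bc D.LO_nn (D.Obc hs ht)
  have o' := gr_of_bc D.LO_nn (D.Obc hs ht')
  have e : ∀ r ∈ Set.Icc 0 T, ∀ r' ∈ Set.Icc 0 T,
      ip b (u r) (Op b (fun j k => a j k s) (u r')) = Bf b (fun j k => a j k s) (u r') (u r) := by
    intro r hr r' hr'
    rw [ip_comm]
    exact Bf_eq (D.co s hs) D.hC D.hb D.hCb (D.fn r' hr') (D.fn r hr)
  rw [ip_q, ip_q, ip_sub_left D.hb D.hCb g' g o, ip_sub_left D.hb D.hCb g' g o',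
    e _ ht _ ht, e _ ht' _ ht', e _ ht' _ ht, e _ ht _ ht', Bf_symm (D.co s hs) (u := u t') (g := u t), slope_def_field]
  ring

/-- time derivative of hh -/
noncomputable def Hd {n : ℕ} (b : ℝ) (u du : ℝ → (Fin n → ℝ) → ℂ) (t : ℝ) : ℝ := 2 * ip b (du t) (u t)

lemma Dy.h_deriv (D : Dy T C M lam b μ a u du) {t : ℝ} (ht : t ∈ Set.Icc 0 T) :
    HasDerivWithinAt (fun t => hh b (u t)) (Hd b u du t) (Set.Icc 0 T) t := by
  rw [hasDerivWithinAt_iff_tendsto_slope]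
  have g := (D.fn t ht).g0 D.hC
  have d := D.dug ht
  have h1 : Tendsto (fun t' => ip b (fun x => qq u t t' x - du t x) (fun x => u t' x + u t x))
      (𝓝[Set.Icc 0 T \ {t}] t) (𝓝 0) := by
    refine tend0 (K := C + C) (L := C + C) (C := C) D.hb D.hCb (by linarith [D.hC]) (by linarith [D.hC]) ?_ ?_ ?_
    · filter_upwards [mem_diff_ev] with t' h
      exact (two_bd (D.qbc ht h.1) (D.dubc ht)).2
    · filter_upwards [mem_diff_ev] with t' h
      exact (two_bd (D.ubc h.1) (D.ubc ht)).1
    · intro x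
      simpa using (D.q_tend subset_rfl ht x).sub_const (du t x)
  have h2 : Tendsto (fun t' => ip b (fun x => u t' x - u t x) (du t))
      (𝓝[Set.Icc 0 T \ {t}] t) (𝓝 0) := by
    refine tend0 (K := C + C) (L := C) (C := C) D.hb D.hCb (by linarith [D.hC]) (by linarith [D.hC]) ?_ ?_ ?_
    · filter_upwards [mem_diff_ev] with t' h
      exact (two_bd (D.ubc h.1) (D.ubc ht)).2
    · exact Eventually.of_forall fun _ => D.dubc ht
    · intro x
      have := (D.u_tend subset_rfl ht x).mono_left (nhdsWithin_mono t (Set.sdiff_subset (t := {t})))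
      simpa using this.sub_const (u t x)
  have h3 := (h1.add h2).add_const (Hd b u du t)
  rw [add_zero, zero_add] at h3
  refine h3.congr' ?_
  filter_upwards [mem_diff_ev] with t' h
  have g' := (D.fn t' h.1).g0 D.hC
  have q := D.q_gr ht h.1
  rw [D.h_slope ht h.1, ip_sub_left D.hb D.hCb q d (g'.add g), ip_sub_left D.hb D.hCb g' g d,
    ip_add_right D.hb D.hCb g' g d, Hd, ip_comm (u t'), ip_comm (u t)]
  ring

lemma Dy.h_cont (D : Dy T C M lam b μ a u du) : ContinuousOn (fun t => hh b (u t)) (Set.Icc 0 T) :=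
  fun t ht => (D.h_deriv ht).continuousWithinAt

lemma Dy.Hd_cont (D : Dy T C M lam b μ a u du) : ContinuousOn (Hd b u du) (Set.Icc 0 T) := by
  intro t ht
  have g := (D.fn t ht).g0 D.hC
  have d := D.dug ht
  have h1 : Tendsto (fun t' => ip b (fun x => du t' x - du t x) (u t'))
      (𝓝[Set.Icc 0 T] t) (𝓝 0) := by
    refine tend0 (K := C + C) (L := C) (C := C) D.hb D.hCb (by linarith [D.hC]) (by linarith [D.hC]) ?_ ?_ ?_
    · filter_upwards [mem_ev] with t' h
      exact (two_bd (D.dubc h) (D.dubc ht)).2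
    · filter_upwards [mem_ev] with t' h
      exact D.ubc h
    · intro x
      simpa using (D.du_tend subset_rfl ht x).sub_const (du t x)
  have h2 : Tendsto (fun t' => ip b (fun x => u t' x - u t x) (du t))
      (𝓝[Set.Icc 0 T] t) (𝓝 0) := by
    refine tend0 (K := C + C) (L := C) (C := C) D.hb D.hCb (by linarith [D.hC]) (by linarith [D.hC]) ?_ ?_ ?_
    · filter_upwards [mem_ev] with t' h
      exact (two_bd (D.ubc h) (D.ubc ht)).2
    · exact Eventually.of_forall fun _ => D.dubc ht
    · intro x
      simpa using (D.u_tend subset_rfl ht x).sub_const (u t x)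
  have h3 := ((h1.add h2).const_mul 2).add_const (Hd b u du t)
  rw [add_zero, mul_zero, zero_add] at h3
  refine h3.congr' ?_
  filter_upwards [mem_ev] with t' h
  have g' := (D.fn t' h).g0 D.hC
  have d' := D.dug h
  rw [ip_sub_left D.hb D.hCb d' d g', ip_sub_left D.hb D.hCb g' g d,
    Hd, Hd, ip_comm (u t'), ip_comm (u t)]
  ring

lemma Dy.E_cont (D : Dy T C M lam b μ a u du) {s : ℝ} (hs : s ∈ Set.Icc 0 T) :
    ContinuousOn (fun t => Bf b (fun j k => a j k s) (u t) (u t)) (Set.Icc 0 T) := by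
  intro t ht
  have g := (D.fn t ht).g0 D.hC
  have o := gr_of_bc D.LO_nn (D.Obc hs ht)
  have h1 : Tendsto (fun t' => ip b (fun x => u t' x - u t x) (Op b (fun j k => a j k s) (u t')))
      (𝓝[Set.Icc 0 T] t) (𝓝 0) := by
    refine tend0 (K := C + C) (L := LO n M C b) (C := C) D.hb D.hCb (by linarith [D.hC]) D.LO_nn ?_ ?_ ?_
    · filter_upwards [mem_ev] with t' h
      exact (two_bd (D.ubc h) (D.ubc ht)).2
    · filter_upwards [mem_ev] with t' h
      exact D.Obc hs h
    · intro x
      simpa using (D.u_tend subset_rfl ht x).sub_const (u t x)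
  have h2 : Tendsto (fun t' => ip b (fun x => u t' x - u t x) (Op b (fun j k => a j k s) (u t)))
      (𝓝[Set.Icc 0 T] t) (𝓝 0) := by
    refine tend0 (K := C + C) (L := LO n M C b) (C := C) D.hb D.hCb (by linarith [D.hC]) D.LO_nn ?_ ?_ ?_
    · filter_upwards [mem_ev] with t' h
      exact (two_bd (D.ubc h) (D.ubc ht)).2
    · exact Eventually.of_forall fun _ => D.Obc hs ht
    · intro x
      simpa using (D.u_tend subset_rfl ht x).sub_const (u t x)
  have h3 := (h1.add h2).add_const (Bf b (fun j k => a j k s) (u t) (u t))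
  rw [add_zero, zero_add] at h3
  refine h3.congr' ?_
  filter_upwards [mem_ev] with t' h
  have g' := (D.fn t' h).g0 D.hC
  have o' := gr_of_bc D.LO_nn (D.Obc hs h)
  have e : ∀ r ∈ Set.Icc 0 T, ∀ r' ∈ Set.Icc 0 T,
      ip b (u r) (Op b (fun j k => a j k s) (u r')) = Bf b (fun j k => a j k s) (u r') (u r) := by
    intro r hr r' hr'
    rw [ip_comm]
    exact Bf_eq (D.co s hs) D.hC D.hb D.hCb (D.fn r' hr') (D.fn r hr)
  rw [ip_sub_left D.hb D.hCb g' g o, ip_sub_left D.hb D.hCb g' g o',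
    e _ ht _ ht, e _ h _ h, e _ h _ ht, e _ ht _ h, Bf_symm (D.co s hs) (u := u t') (g := u t)]
  ring

/-- difference of E slope and the average of G tends to 0 -/
lemma Dy.E_err (D : Dy T C M lam b μ a u du) {s : ℝ} (hs : s ∈ Set.Icc 0 T)
    {J : Set ℝ} (hJ : J ⊆ Set.Icc 0 T) {t : ℝ} (ht : t ∈ J) :
    Tendsto (fun t' => slope (fun t => Bf b (fun j k => a j k s) (u t) (u t)) t t' -
      (ip b (du t') (Op b (fun j k => a j k s) (u t')) + ip b (du t) (Op b (fun j k => a j k s) (u t))))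
      (𝓝[J \ {t}] t) (𝓝 0) := by
  have h1 : Tendsto (fun t' => ip b (fun x => qq u t t' x - du t' x) (Op b (fun j k => a j k s) (u t')))
      (𝓝[J \ {t}] t) (𝓝 0) := by
    refine tend0 (K := C + C) (L := LO n M C b) (C := C) D.hb D.hCb (by linarith [D.hC]) D.LO_nn ?_ ?_ ?_
    · filter_upwards [mem_diff_ev] with t' h
      exact (two_bd (D.qbc (hJ ht) (hJ h.1)) (D.dubc (hJ h.1))).2
    · filter_upwards [mem_diff_ev] with t' h
      exact D.Obc hs (hJ h.1)
    · intro x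
      have := (D.du_tend hJ ht x).mono_left (nhdsWithin_mono t (Set.sdiff_subset (t := {t})))
      simpa using (D.q_tend hJ ht x).sub this
  have h2 : Tendsto (fun t' => ip b (fun x => qq u t t' x - du t x) (Op b (fun j k => a j k s) (u t)))
      (𝓝[J \ {t}] t) (𝓝 0) := by
    refine tend0 (K := C + C) (L := LO n M C b) (C := C) D.hb D.hCb (by linarith [D.hC]) D.LO_nn ?_ ?_ ?_
    · filter_upwards [mem_diff_ev] with t' h
      exact (two_bd (D.qbc (hJ ht) (hJ h.1)) (D.dubc (hJ ht))).2
    · exact Eventually.of_forall fun _ => D.Obc hs (hJ ht)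
    · intro x
      simpa using (D.q_tend hJ ht x).sub_const (du t x)
  have h3 := h1.add h2
  rw [add_zero] at h3
  refine h3.congr' ?_
  filter_upwards [mem_diff_ev] with t' h
  have o := gr_of_bc D.LO_nn (D.Obc hs (hJ ht))
  have o' := gr_of_bc D.LO_nn (D.Obc hs (hJ h.1))
  have q := D.q_gr (hJ ht) (hJ h.1)
  rw [D.E_slope hs (hJ ht) (hJ h.1), ip_sub_left D.hb D.hCb q (D.dug (hJ h.1)) o',
    ip_sub_left D.hb D.hCb q (D.dug (hJ ht)) o]
  ring

end dy

/-- abstract quotient-slope lemma -/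
lemma quot_slope {J : Set ℝ} {t : ℝ} (ht : t ∈ J) {E h H G P : ℝ → ℝ} (hE : ContinuousOn E J)
    (hpos : ∀ t ∈ J, 0 < h t)
    (hh : HasDerivWithinAt h (H t) J t) (hh' : ContinuousOn h J) (hH : ContinuousOn H J) (hP : ContinuousOn P J)
    (herr : Tendsto (fun t' => slope E t t' - (G t' + G t)) (𝓝[J \ {t}] t) (𝓝 0))
    (hG : ∀ t ∈ J, -(P t * h t) ≤ 2 * G t - (E t / h t) * H t) (r : ℝ) (hr : P t < r) :
    ∀ᶠ t' in 𝓝[J \ {t}] t, - r < slope (fun t => E t / h t) t t' := by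
  have hsub : 𝓝[J \ {t}] t ≤ 𝓝[J] t := nhdsWithin_mono t (Set.sdiff_subset (t := {t}))
  set Γ : ℝ → ℝ := fun t => E t / h t * H t - P t * h t with hΓ
  have cΓ : ContinuousOn Γ J :=
    ((hE.div hh' fun x hx => (hpos x hx).ne').mul hH).sub (hP.mul hh')
  have tΓ : Tendsto Γ (𝓝[J \ {t}] t) (𝓝 (Γ t)) := (cΓ t ht).mono_left hsub
  have th : Tendsto h (𝓝[J \ {t}] t) (𝓝 (h t)) := (hh' t ht).mono_left hsub
  have ts := hasDerivWithinAt_iff_tendsto_slope.1 hh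
  have h0 := hpos t ht
  have hlow : Tendsto (fun t' => (((slope E t t' - (G t' + G t)) + (Γ t' + Γ t) / 2) * h t -
      E t * slope h t t') / (h t * h t')) (𝓝[J \ {t}] t)
      (𝓝 (((0 + (Γ t + Γ t) / 2) * h t - E t * H t) / (h t * h t))) := by
    refine Tendsto.div ?_ (th.const_mul _) (by positivity)
    exact ((herr.add ((tΓ.add_const _).div_const 2)).mul_const _).sub (ts.const_mul _)
  have hval : ((0 + (Γ t + Γ t) / 2) * h t - E t * H t) / (h t * h t) = - P t := by
    simp only [hΓ]; field_simp; ring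
  rw [hval] at hlow
  have hev := hlow.eventually (lt_mem_nhds (show -r < -P t by linarith))
  filter_upwards [hev, mem_diff_ev] with t' h1 h2
  refine h1.trans_le ?_
  have h0' := hpos t' h2.1
  have e : slope (fun t => E t / h t) t t' = (slope E t t' * h t - E t * slope h t t') / (h t * h t') := by
    have : t' - t ≠ 0 := sub_ne_zero.2 h2.2
    simp only [slope_def_field]
    field_simp
    ring
  rw [e]
  refine div_le_div_of_nonneg_right ?_ (by positivity)
  have a1 := hG t ht
  have a2 := hG t' h2.1
  have : (Γ t' + Γ t) / 2 ≤ G t' + G t := by simp only [hΓ]; linarith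
  have := mul_le_mul_of_nonneg_right this h0.le
  linarith

lemma fence {K η R s t2 : ℝ} {Q : ℝ → ℝ} (hK : 1 ≤ K) (hη : 0 ≤ η) (hKη : K * η ^ 2 ≤ 1) (hR : 1 ≤ R)
    (hts : t2 ≤ s) (hlen : s - t2 ≤ 1 / (7 * K * R)) (hQc : ContinuousOn Q (Set.Icc t2 s))
    (hQ0 : ∀ t ∈ Set.Icc t2 s, 0 ≤ Q t)
    (hQs : ∀ t ∈ Set.Icc t2 s, ∀ r, K * (η ^ 2 * Q t ^ 2 + Q t) < r →
      ∀ᶠ t' in 𝓝[Set.Icc t2 s \ {t}] t, - r < slope Q t t') (hs : Q s ≤ R) :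
    Q t2 ≤ R + (4 * η ^ 2 * R + 3) / 7 := by
  have hη2 : η ^ 2 ≤ 1 := by nlinarith [sq_nonneg η]
  set β := K * (4 * η ^ 2 * R ^ 2 + 3 * R) with hβ
  have hβ0 : 0 ≤ β := by positivity
  have hmul : β * (1 / (7 * K * R)) = (4 * η ^ 2 * R + 3) / 7 := by
    rw [hβ]; field_simp
  have key := image_le_of_liminf_slope_right_lt_deriv_boundary' (f := fun τ => Q (s - τ))
    (f' := fun τ => K * (η ^ 2 * Q (s - τ) ^ 2 + Q (s - τ))) (a := 0) (b := s - t2)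
    (B := fun τ => R + τ * β) (B' := fun _ => β) ?_ ?_ ?_ ?_ ?_ ?_ (x := s - t2) ⟨by linarith, le_rfl⟩
  · simp only [sub_sub_cancel] at key
    have := mul_le_mul_of_nonneg_left hlen hβ0
    linarith
  · refine hQc.comp (by fun_prop) fun τ hτ => ⟨?_, ?_⟩ <;> simp only [Set.mem_Icc] at hτ <;> linarith [hτ.1, hτ.2]
  · intro τ hτ r hr
    have hmem : s - τ ∈ Set.Icc t2 s := ⟨by linarith [hτ.2], by linarith [hτ.1]⟩
    have h := hQs _ hmem r hr
    have hmap : Tendsto (fun z => s - z) (𝓝[>] τ) (𝓝[Set.Icc t2 s \ {s - τ}] (s - τ)) := by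
      refine tendsto_nhdsWithin_iff.2 ⟨(Continuous.tendsto (by fun_prop) τ).mono_left nhdsWithin_le_nhds, ?_⟩
      filter_upwards [Ioo_mem_nhdsGT hτ.2] with z hz
      refine ⟨⟨by linarith [hz.2], by linarith [hz.1, hτ.1]⟩, ?_⟩
      simp only [Set.mem_singleton_iff]
      intro h'; linarith [hz.1]
    refine (hmap.eventually h).frequently.mono fun z hz => ?_
    have e : slope (fun τ => Q (s - τ)) τ z = - slope Q (s - τ) (s - z) := by
      simp only [slope_def_field]
      rw [show s - z - (s - τ) = -(z - τ) by ring, div_neg, neg_neg]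
    rw [e]; linarith
  · simpa using hs
  · fun_prop
  · intro τ hτ
    simpa using (((hasDerivAt_id τ).mul_const β).const_add R).hasDerivWithinAt
  · intro τ hτ heq
    have hmem : s - τ ∈ Set.Icc t2 s := ⟨by linarith [hτ.2], by linarith [hτ.1]⟩
    have h0 := hQ0 _ hmem
    have h1 : τ * β ≤ (4 * η ^ 2 * R + 3) / 7 := by
      rw [← hmul, mul_comm]
      exact mul_le_mul_of_nonneg_left (by linarith [hτ.2]) hβ0
    have h2 : Q (s - τ) ≤ 2 * R := by
      have : η ^ 2 * R ≤ R := by nlinarith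
      linarith
    simp only [hβ]
    have h3 : Q (s - τ) ^ 2 ≤ 4 * R ^ 2 := by nlinarith
    have h4 := mul_le_mul_of_nonneg_left h3 (sq_nonneg η)
    refine mul_lt_mul_of_pos_left ?_ (by linarith)
    nlinarith

end BU
open MeasureTheory
set_option linter.unusedSectionVars false
set_option linter.unusedVariables false
namespace BU
open Filter Topology

section dy
variable {n : ℕ} {T C M lam b : ℝ} {μ : ℝ → ℝ} 

lemma E_switch {a a' : Fin n → Fin n → (Fin n → ℝ) → ℝ} {u : (Fin n → ℝ) → ℂ} {η : ℝ}
    (hη : 0 ≤ η) (hlam : 0 < lam) (hM : 0 ≤ M) (hC : 0 ≤ C) (hb : 0 ≤ b) (hCb : C + C < b)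
    (ha : Co M lam a) (ha' : Co M lam a') (hu : Fn C u)
    (hd : ∀ j k x, |a' j k x - a j k x| ≤ M * η) :
    Bf b a' u u ≤ (1 + M * n / lam * η) * Bf b a u u := by
  have gB : ∀ a : Fin n → Fin n → (Fin n → ℝ) → ℝ, Co M lam a →
      Gr (C + C) (fun x => ∑ j, ∑ k, a j k x * inner ℝ (pd k u x) (pd j u x)) := by
    intro a ha
    refine Gr.sum _ fun j _ => Gr.sum _ fun k _ => ?_
    have := (ha.g0 j k).mul ((hu.g1 hC k).inner (hu.g1 hC j))
    rwa [zero_add] at this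
  have gZ := (Zf_gr hC hu).cmul (M * η * n)
  have h1 : Bf b a' u u ≤ I b (fun x => (∑ j, ∑ k, a j k x * inner ℝ (pd k u x) (pd j u x)) +
      M * η * n * Zf u x) := by
    refine I_mono (gB a' ha') ((gB a ha).add gZ) hb hCb fun x => ?_
    have h2 : ∑ j, ∑ k, (a' j k x - a j k x) * inner ℝ (pd k u x) (pd j u x) ≤
        ∑ j, ∑ k, M * η * (‖pd j u x‖ * ‖pd k u x‖) := by
      refine Finset.sum_le_sum fun j _ => Finset.sum_le_sum fun k _ => ?_
      refine (le_abs_self _).trans ?_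
      rw [abs_mul]
      refine mul_le_mul (hd j k x) ?_ (abs_nonneg _) (by positivity)
      rw [mul_comm]
      exact abs_real_inner_le_norm _ _
    have h3 : ∑ j, ∑ k, M * η * (‖pd j u x‖ * ‖pd k u x‖) = M * η * (∑ k, ‖pd k u x‖) ^ 2 := by
      rw [sq, Finset.sum_mul_sum, Finset.mul_sum]
      simp only [Finset.mul_sum]
    have h4 : M * η * (∑ k, ‖pd k u x‖) ^ 2 ≤ M * η * (n * Zf u x) :=
      mul_le_mul_of_nonneg_left (sum_sq_le fun k => ‖pd k u x‖) (by positivity)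
    simp only [sub_mul, Finset.sum_sub_distrib] at h2
    linarith
  rw [I_add (gB a ha) gZ hb hCb, I_cmul] at h1
  have h5 := Z_le hlam hC hb hCb ha hu
  have h6 : I b (Zf u) ≤ Bf b a u u / lam := by rw [le_div_iff₀ hlam]; linarith
  have h7 := mul_le_mul_of_nonneg_left h6 (show 0 ≤ M * η * n by positivity)
  have h8 : Bf b a u u = I b (fun x => ∑ j, ∑ k, a j k x * inner ℝ (pd k u x) (pd j u x)) := rfl
  calc _ ≤ Bf b a u u + M * η * n * (Bf b a u u / lam) := by rw [h8] at h7 ⊢; linarith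
    _ = _ := by ring

lemma Bf_nonneg {a : Fin n → Fin n → (Fin n → ℝ) → ℝ} {u : (Fin n → ℝ) → ℂ}
    (hlam : 0 < lam) (hC : 0 ≤ C) (hb : 0 ≤ b) (hCb : C + C < b)
    (ha : Co M lam a) (hu : Fn C u) : 0 ≤ Bf b a u u := by
  refine le_trans ?_ (Z_le hlam hC hb hCb ha hu)
  refine mul_nonneg hlam.le (I_nonneg fun x => ?_)
  unfold Zf; positivity

variable {a : Fin n → Fin n → ℝ → (Fin n → ℝ) → ℝ} {u du : ℝ → (Fin n → ℝ) → ℂ}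

/-- the (shifted) frequency function with coefficients frozen at time s -/
noncomputable def Qf {n : ℕ} (b : ℝ) (a : Fin n → Fin n → ℝ → (Fin n → ℝ) → ℝ)
    (u : ℝ → (Fin n → ℝ) → ℂ) (s t : ℝ) : ℝ :=
  Bf b (fun j k => a j k s) (u t) (u t) / hh b (u t) + 1

lemma Dy.frozen (D : Dy T C M lam b μ a u du) {K η R s t : ℝ}
    (hK : 1 ≤ K)
    (hg : ∀ τ ∈ Set.Icc t s, I b (fun x => ‖du τ x - Op b (fun j k => a j k s) (u τ) x‖ ^ 2) ≤
      K * (η ^ 2 * I b (fun x => ‖Op b (fun j k => a j k s) (u τ) x‖ ^ 2) +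
        Bf b (fun j k => a j k s) (u τ) (u τ) + hh b (u τ)))
    (hη : 0 ≤ η) (hKη : K * η ^ 2 ≤ 1) (hR : 1 ≤ R) (h0 : 0 ≤ t) (hts : t ≤ s) (hsT : s ≤ T)
    (hlen : s - t ≤ 1 / (7 * K * R)) (hpos : ∀ τ ∈ Set.Icc t s, 0 < hh b (u τ))
    (hs : Qf b a u s s ≤ R) : Qf b a u s t ≤ R + (4 * η ^ 2 * R + 3) / 7 := by
  have hJ : Set.Icc t s ⊆ Set.Icc 0 T := Set.Icc_subset_Icc h0 hsT
  have hsm : s ∈ Set.Icc 0 T := ⟨h0.trans hts, hsT⟩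
  have cE := (D.E_cont hsm).mono hJ
  have ch := D.h_cont.mono hJ
  have cQ : ContinuousOn (Qf b a u s) (Set.Icc t s) :=
    (cE.div ch fun x hx => (hpos x hx).ne').add continuousOn_const
  refine fence hK hη hKη hR hts hlen cQ ?_ ?_ hs
  · intro τ hτ
    have := Bf_nonneg D.hlam D.hC D.hb D.hCb (D.co s hsm) (D.fn τ (hJ hτ))
    have := hpos τ hτ
    unfold Qf; positivity
  · intro τ hτ r hr
    have key := quot_slope hτ (E := fun t => Bf b (fun j k => a j k s) (u t) (u t))
      (h := fun t => hh b (u t)) (H := Hd b u du)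
      (G := fun τ => ip b (du τ) (Op b (fun j k => a j k s) (u τ)))
      (P := fun τ => K * (η ^ 2 * Qf b a u s τ ^ 2 + Qf b a u s τ)) cE hpos
      ((D.h_deriv (hJ hτ)).mono hJ) ch (D.Hd_cont.mono hJ)
      (continuousOn_const.mul ((continuousOn_const.mul (cQ.pow 2)).add cQ))
      (D.E_err hsm hJ hτ) ?_ r hr
    · filter_upwards [key] with t' h
      refine h.trans_eq ?_
      simp only [slope_def_field, Qf]
      ring
    · intro σ hσ
      have := static_key hK hη D.hlam D.hC D.hb D.hCb (D.co s hsm) (D.fn σ (hJ hσ)) (D.dug (hJ hσ))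
        (hg σ hσ) hKη (hpos σ hσ)
      exact this

end dy
section dy
variable {n : ℕ} {T C M lam b : ℝ} {μ : ℝ → ℝ}
variable {a : Fin n → Fin n → ℝ → (Fin n → ℝ) → ℝ} {u du : ℝ → (Fin n → ℝ) → ℂ}

lemma Dy.Q_bounded (D : Dy T C M lam b μ a u du) 
    (hμ_cont : ContinuousOn μ (Set.Icc 0 1))
    (hμ_mono : StrictMonoOn μ (Set.Icc 0 1)) (hμ_zero : μ 0 = 0)
    (hμ_conc : ConcaveOn ℝ (Set.Icc 0 1) μ) (hμ_mem : ∀ s ∈ Set.Icc (0:ℝ) 1, μ s ∈ Set.Icc (0:ℝ) 1)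
    (hOsgood : ∫⁻ s in Set.Ioo (0:ℝ) 1, ENNReal.ofReal (1 / μ s) = ⊤)
    {t0 t1 : ℝ} (h00 : 0 ≤ t0) (h01 : t0 < t1) (h1T : t1 ≤ T)
    (hpos : ∀ τ, t0 < τ → τ ≤ t1 → 0 < hh b (u τ)) :
    ∃ B, ∀ t, t0 < t → t ≤ t1 → Qf b a u t t ≤ B := by
  obtain ⟨K, hK, hgK⟩ := g_L2 n M lam C b D.hlam D.hM D.hC D.hb D.hCb
  have hK0 : 0 < K := by linarith
  -- smallness
  have hcont : Tendsto (fun e => K * μ e ^ 2) (𝓝[Set.Icc 0 1] 0) (𝓝 0) := by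
    have := ((hμ_cont 0 (by simp)).tendsto.pow 2).const_mul K
    simpa [hμ_zero] using this
  have hev := hcont.eventually (gt_mem_nhds (show (0:ℝ) < 1 by norm_num))
  obtain ⟨δ, hδ, hδ'⟩ := Metric.mem_nhdsWithin_iff.1 hev
  set R0 := max 1 (1 / (7 * K * (δ / 2))) with hR0
  have hμ1 : 0 < μ 1 := mu_pos hμ_mono hμ_zero (by norm_num) le_rfl
  set c6 := M * n / lam with hc6
  have hc60 : 0 ≤ c6 := by have := D.hM; have := D.hlam; positivity
  set c8 := 1 + 7 * K / μ 1 with hc8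
  have hc80 : 0 ≤ c8 := by positivity
  refine osgood_bound hμ_mono hμ_zero hμ_conc hμ_mem hOsgood (κ := 7 * K) (c := c6 + c8 + c6 * c8)
    (R0 := R0) h01 (by linarith) (by positivity) (le_max_left _ _) (fun t => Qf b a u t t) ?_
  intro s t R ht hts hs1 hR hlen hQ
  have hR1 : 1 ≤ R := (le_max_left _ _).trans hR
  have hR2 : 1 / (7 * K * (δ / 2)) ≤ R := (le_max_right _ _).trans hR
  set ε := 1 / (7 * K * R) with hε
  have hKR : 7 ≤ 7 * K * R := by nlinarith
  have hε0 : 0 < ε := by positivity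
  have hε1 : ε < 1 := by rw [hε, div_lt_one (by positivity)]; linarith
  have hεδ : ε < δ := by
    have : ε ≤ δ / 2 := by
      rw [hε, div_le_iff₀ (by positivity)]
      rw [div_le_iff₀ (by positivity)] at hR2
      linarith
    linarith
  have hKη : K * μ ε ^ 2 ≤ 1 := by
    have : ε ∈ {x | K * μ x ^ 2 < 1} := hδ' ⟨by simp [abs_of_pos hε0, hεδ], hε0.le, hε1.le⟩
    exact le_of_lt this
  obtain ⟨hη0, hη1⟩ := hμ_mem ε ⟨hε0.le, hε1.le⟩
  have h0t : 0 ≤ t := h00.trans ht.le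
  have hsT : s ≤ T := hs1.trans h1T
  have hJ : Set.Icc t s ⊆ Set.Icc 0 T := Set.Icc_subset_Icc h0t hsT
  have hsm : s ∈ Set.Icc 0 T := ⟨h0t.trans hts, hsT⟩
  have htm : t ∈ Set.Icc 0 T := hJ ⟨le_rfl, hts⟩
  have habs : ∀ τ ∈ Set.Icc t s, |s - τ| < 1 ∧ M * μ |s - τ| ≤ M * μ ε := by
    intro τ hτ
    have h1 : |s - τ| ≤ ε := by rw [abs_of_nonneg (by linarith [hτ.2])]; linarith [hτ.1]
    refine ⟨by linarith, mul_le_mul_of_nonneg_left ?_ D.hM⟩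
    exact hμ_mono.monotoneOn ⟨abs_nonneg _, by linarith⟩ ⟨hε0.le, hε1.le⟩ h1
  have hp : ∀ τ ∈ Set.Icc t s, 0 < hh b (u τ) := fun τ hτ => hpos τ (by linarith [hτ.1]) (by linarith [hτ.2])
  have hfr := D.frozen (η := μ ε) (R := R) (s := s) (t := t) hK (fun τ hτ =>
    hgK _ (fun j k => a j k τ) _ _ (μ ε) hη0 hη1 (D.co s hsm) (D.co τ (hJ hτ)) (D.fn τ (hJ hτ)) (D.dug (hJ hτ))
      (fun j k x => (D.md s hsm τ (hJ hτ) (habs τ hτ).1 j k x).trans (habs τ hτ).2)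
      (fun i j k x => (D.md' s hsm τ (hJ hτ) (habs τ hτ).1 i j k x).trans (habs τ hτ).2)
      (D.pde τ (hJ hτ))) hη0 hKη hR1 h0t hts hsT hlen hp hQ
  have htI : t ∈ Set.Icc t s := ⟨le_rfl, hts⟩
  have hsw := E_switch (b := b) (u := u t) hη0 D.hlam D.hM D.hC D.hb D.hCb (D.co s hsm) (D.co t htm) (D.fn t htm)
    (fun j k x => by
      rw [abs_sub_comm]
      exact (D.md s hsm t htm (habs t htI).1 j k x).trans (habs t htI).2)
  have hht := hp t htI
  set η := μ ε with hηd
  have hQs : Qf b a u t t ≤ (1 + c6 * η) * Qf b a u s t := by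
    unfold Qf
    have h1 : Bf b (fun j k => a j k t) (u t) (u t) / hh b (u t) ≤
        (1 + c6 * η) * (Bf b (fun j k => a j k s) (u t) (u t) / hh b (u t)) := by
      rw [← mul_div_assoc]
      exact div_le_div_of_nonneg_right hsw hht.le
    have h2 : 0 ≤ c6 * η := by positivity
    nlinarith
  have hone : 1 ≤ 7 * K / μ 1 * (η * R) := by
    have := mu_conc hμ_conc hμ_zero (s := 1) (r := ε) (by norm_num) le_rfl hε0.le hε1.le
    rw [mul_one] at this
    have h3 : ε * (7 * K * R) = 1 := by rw [hε]; field_simp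
    rw [div_mul_eq_mul_div, le_div_iff₀ hμ1, one_mul]
    calc μ 1 = ε * μ 1 * (7 * K * R) := by rw [mul_right_comm, h3, one_mul]
      _ ≤ η * (7 * K * R) := mul_le_mul_of_nonneg_right this (by linarith)
      _ = _ := by ring
  have hb1 : Qf b a u s t ≤ R * (1 + c8 * η) := by
    have h4 : η ^ 2 * R ≤ η * R := mul_le_mul_of_nonneg_right (by nlinarith) (by linarith)
    have h5 : 0 ≤ η * R := by positivity
    rw [hc8]
    nlinarith
  calc Qf b a u t t ≤ (1 + c6 * η) * Qf b a u s t := hQs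
    _ ≤ (1 + c6 * η) * (R * (1 + c8 * η)) := mul_le_mul_of_nonneg_left hb1 (by positivity)
    _ = R * (1 + (c6 + c8) * η + c6 * c8 * (η * η)) := by ring
    _ ≤ R * (1 + (c6 + c8) * η + c6 * c8 * η) := by
      have : η * η ≤ η := by nlinarith
      gcongr
    _ = _ := by ring

lemma Dy.hh_zero (D : Dy T C M lam b μ a u du) {t : ℝ} (ht : t ∈ Set.Icc 0 T) (h : hh b (u t) = 0) (x : Fin n → ℝ) :
    u t x = 0 := by
  have g := ((D.fn t ht).g0 D.hC).normsq
  have hitg := g.int D.hb D.hCb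
  have hc : Continuous (fun x => ‖u t x‖ ^ 2 * wt b x) := g.cont.mul (wt_contDiff b).continuous
  have hnn : (0 : (Fin n → ℝ) → ℝ) ≤ fun x => ‖u t x‖ ^ 2 * wt b x := by
    intro x
    have := wt_pos b x
    simp only [Pi.zero_apply]; positivity
  have h1 := (integral_eq_zero_iff_of_nonneg hnn hitg).1 h
  have h2 : ‖u t x‖ ^ 2 * wt b x = 0 := congrFun ((Continuous.ae_eq_iff_eq volume hc continuous_const).1 h1) x
  simpa [(wt_pos b x).ne'] using h2

lemma Dy.main (D : Dy T C M lam b μ a u du) (hT : 0 < T)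
    (hμ_cont : ContinuousOn μ (Set.Icc 0 1))
    (hμ_mono : StrictMonoOn μ (Set.Icc 0 1)) (hμ_zero : μ 0 = 0)
    (hμ_conc : ConcaveOn ℝ (Set.Icc 0 1) μ) (hμ_mem : ∀ s ∈ Set.Icc (0:ℝ) 1, μ s ∈ Set.Icc (0:ℝ) 1)
    (hOsgood : ∫⁻ s in Set.Ioo (0:ℝ) 1, ENNReal.ofReal (1 / μ s) = ⊤)
    (h0 : ∀ x, u 0 x = 0) : ∀ t ∈ Set.Icc 0 T, ∀ x, u t x = 0 := by
  intro t1 ht1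
  by_contra hcon
  have hnn : ∀ t, 0 ≤ hh b (u t) := fun t => I_nonneg fun x => by positivity
  have hp1 : 0 < hh b (u t1) := by
    refine lt_of_le_of_ne (hnn _) fun h => hcon fun x => D.hh_zero ht1 h.symm x
  have hz : hh b (u 0) = 0 := by simp [hh, h0, I]
  set S := Set.Icc 0 t1 ∩ (fun t => hh b (u t)) ⁻¹' {0} with hS
  have hsub : Set.Icc 0 t1 ⊆ Set.Icc 0 T := Set.Icc_subset_Icc le_rfl ht1.2
  have hSc : IsClosed S := (D.h_cont.mono hsub).preimage_isClosed_of_isClosed isClosed_Icc isClosed_singleton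
  have hSn : S.Nonempty := ⟨0, ⟨le_rfl, ht1.1⟩, hz⟩
  have hSb : BddAbove S := ⟨t1, fun x hx => hx.1.2⟩
  set t0 := sSup S with ht0
  obtain ⟨ht0m, ht0z⟩ : t0 ∈ S := hSc.csSup_mem hSn hSb
  simp only [Set.mem_preimage, Set.mem_singleton_iff] at ht0z
  have h01 : t0 < t1 := lt_of_le_of_ne ht0m.2 fun h => by rw [h] at ht0z; linarith
  have hpos : ∀ τ, t0 < τ → τ ≤ t1 → 0 < hh b (u τ) := by
    intro τ h1 h2
    refine lt_of_le_of_ne (hnn _) fun h => ?_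
    have : τ ∈ S := ⟨⟨ht0m.1.trans h1.le, h2⟩, h.symm⟩
    linarith [le_csSup hSb this]
  obtain ⟨B, hB⟩ := D.Q_bounded hμ_cont hμ_mono hμ_zero hμ_conc hμ_mem hOsgood ht0m.1 h01 ht1.2 hpos
  obtain ⟨K, hK, hgK⟩ := g_L2 n M lam C b D.hlam D.hM D.hC D.hb D.hCb
  set κ := (K + 2) * B with hκ
  have hder : ∀ τ, t0 < τ → τ ≤ t1 → Hd b u du τ ≤ κ * hh b (u τ) := by
    intro τ h1 h2
    have hm : τ ∈ Set.Icc 0 T := ⟨ht0m.1.trans h1.le, h2.trans ht1.2⟩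
    have hp := hpos τ h1 h2
    have hgg := hgK (fun j k => a j k τ) (fun j k => a j k τ) (u τ) (du τ) 0 le_rfl zero_le_one (D.co τ hm) (D.co τ hm)
      (D.fn τ hm) (D.dug hm) (by simp) (by simp) (D.pde τ hm)
    have h3 := hderiv_le (K := K) D.hC D.hb D.hCb (D.co τ hm) (D.fn τ hm) (D.dug hm) (by
      refine hgg.trans_eq ?_
      ring)
    have h4 : Bf b (fun j k => a j k τ) (u τ) (u τ) + hh b (u τ) ≤ B * hh b (u τ) := by
      have := mul_le_mul_of_nonneg_right (hB τ h1 h2) hp.le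
      unfold Qf at this
      rwa [add_mul, div_mul_cancel₀ _ hp.ne', one_mul] at this
    calc Hd b u du τ ≤ (K + 2) * (Bf b (fun j k => a j k τ) (u τ) (u τ) + hh b (u τ)) := h3
      _ ≤ (K + 2) * (B * hh b (u τ)) := mul_le_mul_of_nonneg_left h4 (by linarith)
      _ = _ := by rw [hκ]; ring
  -- monotone quantity
  have hsub2 : Set.Icc t0 t1 ⊆ Set.Icc 0 T := Set.Icc_subset_Icc ht0m.1 ht1.2
  have hanti : AntitoneOn (fun t => hh b (u t) * Real.exp (-κ * t)) (Set.Icc t0 t1) := by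
    refine antitoneOn_of_hasDerivWithinAt_nonpos (convex_Icc _ _)
      (f' := fun t => Hd b u du t * Real.exp (-κ * t) + hh b (u t) * (Real.exp (-κ * t) * (-κ * 1))) ?_ ?_ ?_
    · exact (D.h_cont.mono hsub2).mul (by fun_prop)
    · intro t ht
      rw [interior_Icc] at ht ⊢
      have hm : t ∈ Set.Icc 0 T := hsub2 ⟨ht.1.le, ht.2.le⟩
      refine ((D.h_deriv hm).mono (Set.Ioo_subset_Icc_self.trans hsub2)).mul ?_
      exact (((hasDerivAt_id t).const_mul (-κ)).exp).hasDerivWithinAt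
    · intro t ht
      rw [interior_Icc] at ht
      have := hder t ht.1 ht.2.le
      have he := Real.exp_pos (-κ * t)
      nlinarith
  have := hanti ⟨le_rfl, h01.le⟩ ⟨h01.le, le_rfl⟩ h01.le
  simp only [ht0z, zero_mul] at this
  have := mul_pos hp1 (Real.exp_pos (-κ * t1))
  linarith

end dy
end BU
open MeasureTheory
namespace BU

lemma pd_sub_le_iter {n : ℕ} (f g : (Fin n → ℝ) → ℝ) (i : Fin n) (x : Fin n → ℝ) :
    |pd i f x - pd i g x| ≤ ‖iteratedFDeriv ℝ 1 f x - iteratedFDeriv ℝ 1 g x‖ := by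
  have h := (iteratedFDeriv ℝ 1 f x - iteratedFDeriv ℝ 1 g x).le_opNorm (fun _ => Pi.single i 1)
  have h1 : ‖(Pi.single i 1 : Fin n → ℝ)‖ ≤ 1 := by simpa using single_norm_le i 1 (by simp)
  simp only [ContinuousMultilinearMap.sub_apply, iteratedFDeriv_one_apply, Finset.univ_unique,
    Finset.prod_singleton, Real.norm_eq_abs] at h
  refine h.trans ?_
  exact mul_le_of_le_one_right (norm_nonneg _) h1

lemma pd_le_iter {n : ℕ} (f : (Fin n → ℝ) → ℝ) (i : Fin n) (x : Fin n → ℝ) :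
    |pd i f x| ≤ ‖iteratedFDeriv ℝ 1 f x‖ := by
  have h := (iteratedFDeriv ℝ 1 f x).le_opNorm (fun _ => Pi.single i 1)
  have h1 : ‖(Pi.single i 1 : Fin n → ℝ)‖ ≤ 1 := by simpa using single_norm_le i 1 (by simp)
  simp only [iteratedFDeriv_one_apply, Finset.univ_unique,
    Finset.prod_singleton, Real.norm_eq_abs] at h
  refine h.trans ?_
  exact mul_le_of_le_one_right (norm_nonneg _) h1

end BU

/-- (Backward uniqueness, exponential-growth class `ℋ₂`.) Under
the same hypotheses on the coefficients as in Statement 0, if `u` is continuous,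
`C¹` in `t`, `C²` in `x`, and `u, ∂_t u, ∂_{x_j} u, ∂_{x_j}∂_{x_k} u` are all
bounded by `C e^{C |x|}` on `[0,T] × ℝⁿ` for some `C > 0`, solves
`∂_t u + Σ_{jk} ∂_{x_j}(a_{jk} ∂_{x_k} u) + Σ_j b_j ∂_{x_j} u + c u = 0` on
`[0,T] × ℝⁿ` and `u(0, ·) = 0`, then `u ≡ 0` on `[0,T] × ℝⁿ`. -/
theorem backward_uniqueness_H2
    {n : ℕ} {T : ℝ} (hT : 0 < T)
    (μ : ℝ → ℝ)
    (hμ_cont : ContinuousOn μ (Set.Icc 0 1))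
    (hμ_conc : ConcaveOn ℝ (Set.Icc 0 1) μ)
    (hμ_mono : StrictMonoOn μ (Set.Icc 0 1))
    (hμ_zero : μ 0 = 0)
    (hμ_mem : ∀ s ∈ Set.Icc (0:ℝ) 1, μ s ∈ Set.Icc (0:ℝ) 1)
    (hOsgood : ∫⁻ s in Set.Ioo (0:ℝ) 1, ENNReal.ofReal (1 / μ s) = ⊤)
    (a : Fin n → Fin n → ℝ → (Fin n → ℝ) → ℝ)
    (ha_x : ∀ j k, ∀ t ∈ Set.Icc 0 T, ContDiff ℝ 2 (a j k t))
    (ha_bdd : ∃ M, ∀ j k, ∀ t ∈ Set.Icc 0 T, ∀ x,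
      |a j k t x| ≤ M ∧ ‖iteratedFDeriv ℝ 1 (a j k t) x‖ ≤ M ∧
        ‖iteratedFDeriv ℝ 2 (a j k t) x‖ ≤ M)
    (ha_mod : ∃ M, ∀ j k, ∀ t ∈ Set.Icc 0 T, ∀ s ∈ Set.Icc 0 T, |t - s| < 1 → ∀ x,
      |a j k t x - a j k s x| ≤ M * μ |t - s| ∧
      ‖iteratedFDeriv ℝ 1 (a j k t) x - iteratedFDeriv ℝ 1 (a j k s) x‖ ≤ M * μ |t - s| ∧
      ‖iteratedFDeriv ℝ 2 (a j k t) x - iteratedFDeriv ℝ 2 (a j k s) x‖ ≤ M * μ |t - s|)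
    (ha_symm : ∀ j k t x, a j k t x = a k j t x)
    (lam₀ : ℝ) (hlam₀ : lam₀ ∈ Set.Ioc (0:ℝ) 1)
    (ha_ell : ∀ t ∈ Set.Icc 0 T, ∀ x ξ : Fin n → ℝ,
      lam₀ * (∑ j, ξ j ^ 2) ≤ ∑ j, ∑ k, a j k t x * ξ j * ξ k)
    (b : Fin n → ℝ → (Fin n → ℝ) → ℂ) (c : ℝ → (Fin n → ℝ) → ℂ)
    (hb_meas : ∀ j, Measurable (fun p : ℝ × (Fin n → ℝ) => b j p.1 p.2))
    (hb_bdd : ∃ M, ∀ j t x, ‖b j t x‖ ≤ M)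
    (hc_meas : Measurable (fun p : ℝ × (Fin n → ℝ) => c p.1 p.2))
    (hc_bdd : ∃ M, ∀ t x, ‖c t x‖ ≤ M)
    (u du : ℝ → (Fin n → ℝ) → ℂ)
    (hu_cont : ContinuousOn (fun p : ℝ × (Fin n → ℝ) => u p.1 p.2)
      (Set.Icc 0 T ×ˢ Set.univ))
    (hu_t : ∀ t ∈ Set.Icc 0 T, ∀ x,
      HasDerivWithinAt (fun s => u s x) (du t x) (Set.Icc 0 T) t)
    (hdu_cont : ContinuousOn (fun p : ℝ × (Fin n → ℝ) => du p.1 p.2)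
      (Set.Icc 0 T ×ˢ Set.univ))
    (hu_x : ∀ t ∈ Set.Icc 0 T, ContDiff ℝ 2 (u t))
    (C : ℝ) (hC : 0 < C)
    (hgrowth : ∀ t ∈ Set.Icc 0 T, ∀ x : Fin n → ℝ,
      ‖u t x‖ ≤ C * Real.exp (C * ‖x‖) ∧
      ‖du t x‖ ≤ C * Real.exp (C * ‖x‖) ∧
      (∀ j, ‖fderiv ℝ (u t) x (Pi.single j 1)‖ ≤ C * Real.exp (C * ‖x‖)) ∧
      (∀ j k, ‖fderiv ℝ (fun y => fderiv ℝ (u t) y (Pi.single k 1)) x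
        (Pi.single j 1)‖ ≤ C * Real.exp (C * ‖x‖)))
    (hPDE : ∀ t ∈ Set.Icc 0 T, ∀ x,
      du t x
        + (∑ j, fderiv ℝ
            (fun y => ∑ k, ((a j k t y : ℝ) : ℂ) * fderiv ℝ (u t) y (Pi.single k 1))
            x (Pi.single j 1))
        + (∑ j, b j t x * fderiv ℝ (u t) x (Pi.single j 1))
        + c t x * u t x = 0)
    (hinit : ∀ x, u 0 x = 0) :
    ∀ t ∈ Set.Icc 0 T, ∀ x, u t x = 0 := by
  obtain ⟨M1, hM1⟩ := ha_bdd
  obtain ⟨M2, hM2⟩ := ha_mod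
  obtain ⟨M3, hM3⟩ := hb_bdd
  obtain ⟨M4, hM4⟩ := hc_bdd
  set M := |M1| + |M2| + |M3| + |M4| with hM
  have p1 := abs_nonneg M1
  have p2 := abs_nonneg M2
  have p3 := abs_nonneg M3
  have p4 := abs_nonneg M4
  have hM0 : 0 ≤ M := by positivity
  have q1 : M1 ≤ M := by linarith [le_abs_self M1]
  have q2 : M2 ≤ M := by linarith [le_abs_self M2]
  have q3 : M3 ≤ M := by linarith [le_abs_self M3]
  have q4 : M4 ≤ M := by linarith [le_abs_self M4]
  have hfe : ∀ t (y : Fin n → ℝ) j, ∑ k, ((a j k t y : ℝ) : ℂ) * fderiv ℝ (u t) y (Pi.single k 1) =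
      BU.flux (fun j k => a j k t) (u t) j y := by
    intro t y j
    unfold BU.flux BU.pd
    simp only [Complex.real_smul]
  have hμn : ∀ t ∈ Set.Icc 0 T, ∀ s ∈ Set.Icc 0 T, |t - s| < 1 → M2 * μ |t - s| ≤ M * μ |t - s| :=
    fun t _ s _ h => mul_le_mul_of_nonneg_right q2 (hμ_mem _ ⟨abs_nonneg _, h.le⟩).1
  have D : BU.Dy T C M lam₀ (2 * C + 1) μ a u du := by
    refine ⟨hC.le, by linarith, hM0, hlam₀.1, ?_, ?_, ?_, ?_, hu_t, ?_, ?_, ?_, ?_⟩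
    · intro t ht
      refine ⟨fun j k => (ha_x j k t ht).of_le (by norm_num), fun j k x => (hM1 j k t ht x).1.trans q1, ?_,
        fun j k x => ha_symm j k t x, fun x ξ => ha_ell t ht x ξ⟩
      intro i j k x
      exact (BU.pd_le_iter _ i x).trans ((hM1 j k t ht x).2.1.trans q1)
    · intro t ht s hs h j k x
      exact (hM2 j k t ht s hs h x).1.trans (hμn t ht s hs h)
    · intro t ht s hs h i j k x
      exact (BU.pd_sub_le_iter _ _ i x).trans ((hM2 j k t ht s hs h x).2.1.trans (hμn t ht s hs h))
    · intro t ht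
      exact ⟨hu_x t ht, fun x => (hgrowth t ht x).1, fun j x => (hgrowth t ht x).2.2.1 j,
        fun j k x => (hgrowth t ht x).2.2.2 j k⟩
    · intro t ht
      have : ContinuousOn (fun x : Fin n → ℝ => du t x) Set.univ :=
        hdu_cont.comp (f := fun x : Fin n → ℝ => (t, x)) (by fun_prop) fun x _ => ⟨ht, trivial⟩
      exact continuousOn_univ.1 this
    · intro x
      exact hdu_cont.comp (f := fun t : ℝ => (t, x)) (by fun_prop) fun t ht => ⟨ht, trivial⟩
    · exact fun t ht x => (hgrowth t ht x).2.1
    · intro t ht x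
      have h := hPDE t ht x
      simp only [hfe] at h
      have h' : du t x + ∑ j, BU.pd j (BU.flux (fun j k => a j k t) (u t) j) x =
          -((∑ j, b j t x * fderiv ℝ (u t) x (Pi.single j 1)) + c t x * u t x) := by
        refine eq_neg_of_add_eq_zero_left ?_
        rw [← add_assoc]
        exact h
      rw [h', norm_neg, mul_add, Finset.mul_sum]
      refine (norm_add_le _ _).trans (add_le_add (norm_sum_le_of_le _ fun j _ => ?_) ?_)
      · rw [norm_mul]
        exact mul_le_mul_of_nonneg_right ((hM3 j t x).trans q3) (norm_nonneg _)
      · rw [norm_mul]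
        exact mul_le_mul_of_nonneg_right ((hM4 t x).trans q4) (norm_nonneg _)
  exact D.main hT hμ_cont hμ_mono hμ_zero hμ_conc hμ_mem hOsgood hinit
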